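/- arXiv:2602.23707 — 6 statements merged into one kernel-verified Lean document; each statement's English description precedes it below -/
import Mathlib

section
/- Let F be a field, n ≥ 1, and let M be an n×n matrix over F in which every row sums to 0 and every column sums to 0. Let T be the (n−1)×(n−1) matrix obtained from M by deleting the last row and the last column. Then dim ker M = dim ker T + 1 (kernels of the associated linear maps x ↦ Mx). Moreover, if C is an n×n alternating matrix over F each of whose rows sums to 0, and C' is obtained from C by deleting the last row and column, then the map M ↦ T is a bijection from the set of C-symmetric n×n matrices all of whose rows and columns sum to 0 onto the set of C'-symmetric (n−1)×(n−1) matrices. -/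
open Matrix BigOperators

/-- Extend a tuple by one last entry so that the sum of all entries is zero. -/
def snocNegSum {A : Type*} [AddCommGroup A] {n : ℕ} (v : Fin n → A) : Fin (n + 1) → A :=
  Fin.snoc (α := fun _ => A) v (-∑ i, v i)

@[simp]
theorem snocNegSum_castSucc {A : Type*} [AddCommGroup A] {n : ℕ} (v : Fin n → A) (i : Fin n) :
    snocNegSum v i.castSucc = v i := by
  simp [snocNegSum]

theorem sum_snocNegSum {A : Type*} [AddCommGroup A] {n : ℕ} (v : Fin n → A) :
    ∑ i, snocNegSum v i = 0 := by
  simp [snocNegSum, Fin.sum_univ_castSucc]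

/-- The matrix with zero row and column sums obtained by bordering `T` with a last row and
column. -/
def borderZeroSum {A : Type*} [AddCommGroup A] {n : ℕ} (T : Matrix (Fin n) (Fin n) A) :
    Matrix (Fin (n + 1)) (Fin (n + 1)) A :=
  Matrix.of (snocNegSum fun i => snocNegSum (T i))

theorem borderZeroSum_submatrix {A : Type*} [AddCommGroup A] {n : ℕ}
    (T : Matrix (Fin n) (Fin n) A) :
    (borderZeroSum T).submatrix Fin.castSucc Fin.castSucc = T := by
  ext i j
  simp [borderZeroSum]

theorem borderZeroSum_sum_row {A : Type*} [AddCommGroup A] {n : ℕ}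
    (T : Matrix (Fin n) (Fin n) A) (i : Fin (n + 1)) : ∑ j, borderZeroSum T i j = 0 := by
  induction i using Fin.lastCases with
  | last =>
    simp only [borderZeroSum, Matrix.of_apply]
    conv_lhs => enter [2, j]; rw [snocNegSum, Fin.snoc_last]
    simp only [Pi.neg_apply, Finset.sum_apply, Finset.sum_neg_distrib]
    rw [Finset.sum_comm]
    simp [sum_snocNegSum]
  | cast i => simp [borderZeroSum, sum_snocNegSum]

theorem borderZeroSum_sum_col {A : Type*} [AddCommGroup A] {n : ℕ}
    (T : Matrix (Fin n) (Fin n) A) (j : Fin (n + 1)) : ∑ i, borderZeroSum T i j = 0 := by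
  simpa [borderZeroSum] using congrFun (sum_snocNegSum fun i => snocNegSum (T i)) j

/-- Matrices with zero row and column sums are determined by deleting the last row and column. -/
theorem eq_of_submatrix_castSucc_eq {A : Type*} [AddCommGroup A] {n : ℕ}
    {P Q : Matrix (Fin (n + 1)) (Fin (n + 1)) A}
    (hP : ∀ i, ∑ j, P i j = 0) (hP' : ∀ j, ∑ i, P i j = 0)
    (hQ : ∀ i, ∑ j, Q i j = 0) (hQ' : ∀ j, ∑ i, Q i j = 0)
    (h : P.submatrix Fin.castSucc Fin.castSucc = Q.submatrix Fin.castSucc Fin.castSucc) :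
    P = Q := by
  have hcc (i j : Fin n) : P i.castSucc j.castSucc = Q i.castSucc j.castSucc :=
    congrFun (congrFun h i) j
  have hrow (i : Fin n) (j : Fin (n + 1)) : P i.castSucc j = Q i.castSucc j := by
    induction j using Fin.lastCases with
    | last =>
      have := (hP i.castSucc).trans (hQ i.castSucc).symm
      simpa only [Fin.sum_univ_castSucc, hcc, add_right_inj] using this
    | cast j => exact hcc i j
  ext i j
  induction i using Fin.lastCases with
  | last =>
    have := (hP' j).trans (hQ' j).symm
    simpa only [Fin.sum_univ_castSucc, hrow, add_right_inj] using this
  | cast i => exact hrow i j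

theorem mulVec_castSucc_of_sum_row_eq_zero {R : Type*} [CommRing R] {n : ℕ}
    {M : Matrix (Fin (n + 1)) (Fin (n + 1)) R} (hrow : ∀ i, ∑ j, M i j = 0)
    (x : Fin (n + 1) → R) (i : Fin n) :
    (M *ᵥ x) i.castSucc =
      (M.submatrix Fin.castSucc Fin.castSucc *ᵥ
        fun j => x j.castSucc - x (Fin.last n)) i := by
  have h := hrow i.castSucc
  rw [Fin.sum_univ_castSucc] at h
  simp only [mulVec, dotProduct, Fin.sum_univ_castSucc, submatrix_apply, mul_sub,
    Finset.sum_sub_distrib, ← Finset.sum_mul]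
  linear_combination x (Fin.last n) * h

theorem mulVec_eq_zero_iff_submatrix_castSucc {R : Type*} [CommRing R] {n : ℕ}
    {M : Matrix (Fin (n + 1)) (Fin (n + 1)) R} (hrow : ∀ i, ∑ j, M i j = 0)
    (hcol : ∀ j, ∑ i, M i j = 0) (x : Fin (n + 1) → R) :
    M *ᵥ x = 0 ↔
      M.submatrix Fin.castSucc Fin.castSucc *ᵥ
        (fun j => x j.castSucc - x (Fin.last n)) = 0 := by
  refine ⟨fun h => funext fun i => ?_, fun h => ?_⟩
  · rw [← mulVec_castSucc_of_sum_row_eq_zero hrow, h]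
    rfl
  · have hc (i : Fin n) : (M *ᵥ x) i.castSucc = 0 := by
      rw [mulVec_castSucc_of_sum_row_eq_zero hrow, h]
      rfl
    have hs : ∑ i, (M *ᵥ x) i = 0 := by
      simp only [mulVec, dotProduct]
      rw [Finset.sum_comm]
      simp [← Finset.sum_mul, hcol]
    ext i
    induction i using Fin.lastCases with
    | last => simpa [Fin.sum_univ_castSucc, hc] using hs
    | cast i => exact hc i

/-- For a matrix with zero row and column sums, a kernel vector amounts to a kernel vector of the
matrix without its last row and column, together with an arbitrary last entry. -/
def kerEquivKerSubmatrixProd {R : Type*} [CommRing R] {n : ℕ}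
    {M : Matrix (Fin (n + 1)) (Fin (n + 1)) R} (hrow : ∀ i, ∑ j, M i j = 0)
    (hcol : ∀ j, ∑ i, M i j = 0) :
    LinearMap.ker M.mulVecLin ≃ₗ[R]
      LinearMap.ker (M.submatrix Fin.castSucc Fin.castSucc).mulVecLin × R where
  toFun x := (⟨fun j => x.1 j.castSucc - x.1 (Fin.last n),
    (mulVec_eq_zero_iff_submatrix_castSucc hrow hcol x.1).1 x.2⟩, x.1 (Fin.last n))
  invFun y := ⟨Fin.snoc (α := fun _ => R) (fun j => y.1.1 j + y.2) y.2, by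
    have h : M.submatrix Fin.castSucc Fin.castSucc *ᵥ y.1.1 = 0 := y.1.2
    rw [LinearMap.mem_ker, mulVecLin_apply, mulVec_eq_zero_iff_submatrix_castSucc hrow hcol]
    simpa using h⟩
  map_add' x y := by
    ext
    · simp [add_sub_add_comm]
    · simp
  map_smul' c x := by
    ext
    · simp [mul_sub]
    · simp
  left_inv x := by
    ext i
    induction i using Fin.lastCases <;> simp
  right_inv y := by
    ext <;> simp

/-- **Deleting the last row and column of a matrix with zero row and column sums.**
If every row and every column of the `(n+1)×(n+1)` matrix `M` sums to `0` and `T` is obtained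
from `M` by deleting the last row and column, then `dim ker M = dim ker T + 1`.  Moreover, for
`C` alternating with zero row sums, `M ↦ T` is a bijection from `C`-symmetric matrices with zero
row and column sums onto `C'`-symmetric matrices, where `C'` is `C` without its last row and
column. -/
theorem remove_last_row_column (F : Type) [Field F] (n : ℕ)
    (M : Matrix (Fin (n + 1)) (Fin (n + 1)) F)
    (hrow : ∀ i, ∑ j, M i j = 0) (hcol : ∀ j, ∑ i, M i j = 0)
    (C : Matrix (Fin (n + 1)) (Fin (n + 1)) F)
    (hCalt : Cᵀ = -C) (hCdiag : ∀ i, C i i = 0) (hCrow : ∀ i, ∑ j, C i j = 0) :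
    Module.finrank F (LinearMap.ker M.mulVecLin)
        = Module.finrank F
            (LinearMap.ker (M.submatrix (Fin.castSucc) (Fin.castSucc)).mulVecLin) + 1 ∧
      Set.BijOn
        (fun A : Matrix (Fin (n + 1)) (Fin (n + 1)) F =>
          A.submatrix (Fin.castSucc) (Fin.castSucc))
        {A | A - Aᵀ = C ∧ (∀ i, ∑ j, A i j = 0) ∧ (∀ j, ∑ i, A i j = 0)}
        {T : Matrix (Fin n) (Fin n) F |
          T - Tᵀ = C.submatrix (Fin.castSucc) (Fin.castSucc)} := by
  refine ⟨?_, ?_, ?_, ?_⟩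
  · rw [(kerEquivKerSubmatrixProd hrow hcol).finrank_eq, Module.finrank_prod,
      Module.finrank_self]
  · rintro A ⟨hA, -, -⟩
    simp [← hA, transpose_submatrix, submatrix_sub]
  · rintro A ⟨-, hA, hA'⟩ B ⟨-, hB, hB'⟩ h
    exact eq_of_submatrix_castSucc_eq hA hA' hB hB' h
  · intro T hT
    have hr := borderZeroSum_sum_row T
    have hc := borderZeroSum_sum_col T
    have hCcol (j : Fin (n + 1)) : ∑ i, C i j = 0 := by
      have h (i : Fin (n + 1)) : C i j = -C j i := congrFun (congrFun hCalt j) i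
      simp [h, hCrow]
    refine ⟨borderZeroSum T, ⟨?_, hr, hc⟩, borderZeroSum_submatrix T⟩
    refine eq_of_submatrix_castSucc_eq ?_ ?_ hCrow hCcol ?_
    · simp [hr, hc]
    · simp [hr, hc]
    · rw [← show T - Tᵀ = _ from hT, submatrix_sub, Pi.sub_apply, Pi.sub_apply,
        ← transpose_submatrix, borderZeroSum_submatrix]
end

section
/- Let ℓ be a prime power, F_ℓ a finite field with ℓ elements, n ≥ 1, C an n×n alternating matrix over F_ℓ, and V a subspace of F_ℓ^n of dimension r. If V is totally isotropic for C, then the number of n×n matrices M over F_ℓ with M − Mᵀ = C and V ⊆ ker M equals ℓ^{n(n+1)/2 − nr + r(r−1)/2}; if V is not totally isotropic for C, there are no such matrices. Equivalently, since there are exactly ℓ^{n(n+1)/2} C-symmetric matrices, a uniformly random C-symmetric matrix M satisfies V ⊆ ker M with probability ℓ^{−nr + r(r−1)/2} when V is totally isotropic for C, and probability 0 otherwise. -/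
open Matrix BigOperators

/-- A subspace `V ⊆ F^n` is totally isotropic for the bilinear form given by the matrix `C`
if `vᵀ C w = 0` for all `v, w ∈ V`. -/
def TotallyIsotropic {F : Type} [CommRing F] {n : ℕ} (C : Matrix (Fin n) (Fin n) F)
    (V : Submodule F (Fin n → F)) : Prop :=
  ∀ v ∈ V, ∀ w ∈ V, v ⬝ᵥ C.mulVec w = 0

namespace Matrix

/-- Symmetric matrices are functions on unordered pairs of indices. -/
def isSymmEquivSym2 (ι R : Type*) : {D : Matrix ι ι R // D.IsSymm} ≃ (Sym2 ι → R) where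
  toFun D := Sym2.lift ⟨fun i j => D.1 i j, fun i j => (D.2.apply i j).symm⟩
  invFun f := ⟨of fun i j => f s(i, j), by ext i j; simp [Sym2.eq_swap]⟩
  left_inv D := by ext i j; simp
  right_inv f := by ext p; induction p with | _ i j => simp

theorem card_isSymm (ι R : Type*) [Fintype ι] [Fintype R] :
    Nat.card {D : Matrix ι ι R // D.IsSymm} = Fintype.card R ^ (Fintype.card ι + 1).choose 2 := by
  classical
  rw [Nat.card_congr (isSymmEquivSym2 ι R), Nat.card_eq_fintype_card, Fintype.card_fun, Sym2.card]

/-- The solutions of `D - Dᵀ = U - Uᵀ` are the translates by `U` of the symmetric matrices. -/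
def subTransposeEqEquivIsSymm {ι R : Type*} [AddCommGroup R] (U : Matrix ι ι R) :
    {D : Matrix ι ι R // D - Dᵀ = U - Uᵀ} ≃ {D : Matrix ι ι R // D.IsSymm} :=
  (Equiv.subRight U).subtypeEquiv fun D => by
    rw [Equiv.subRight_apply, IsSymm, transpose_sub, sub_eq_sub_iff_sub_eq_sub, ← sub_eq_zero,
      ← sub_eq_zero (a := Dᵀ - Uᵀ), ← neg_eq_zero]
    exact Eq.congr_left (by abel)

theorem exists_sub_transpose_eq {ι R : Type*} [LinearOrder ι] [AddCommGroup R]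
    {C : Matrix ι ι R} (hC : Cᵀ = -C) (hdiag : ∀ i, C i i = 0) :
    ∃ U : Matrix ι ι R, U - Uᵀ = C := by
  refine ⟨of fun i j => if i < j then C i j else 0, ?_⟩
  ext i j
  have h : C j i = -C i j := congrFun (congrFun hC i) j
  rcases lt_trichotomy i j with hij | rfl | hij
  · simp [hij, hij.not_gt]
  · simp [hdiag]
  · simp [hij, hij.not_gt, h]

/-- When the upper left block of `U - Uᵀ` vanishes, a solution of `N - Nᵀ = U - Uᵀ` whose left
columns vanish is determined by its lower right block. -/
def vanishingColumnsEquiv {ι κ R : Type*} [AddCommGroup R] (U : Matrix (ι ⊕ κ) (ι ⊕ κ) R)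
    (h₁₁ : ∀ i j, (U - Uᵀ) (Sum.inl i) (Sum.inl j) = 0) :
    {N : Matrix (ι ⊕ κ) (ι ⊕ κ) R // N - Nᵀ = U - Uᵀ ∧ ∀ k i, N k (Sum.inl i) = 0} ≃
      {D : Matrix κ κ R // D - Dᵀ = U.toBlocks₂₂ - U.toBlocks₂₂ᵀ} where
  toFun N := ⟨N.1.toBlocks₂₂, by
    ext i j; simpa [toBlocks₂₂] using congrFun (congrFun N.2.1 (Sum.inr i)) (Sum.inr j)⟩
  invFun D := ⟨fromBlocks 0 (U - Uᵀ).toBlocks₁₂ 0 D.1, by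
    constructor
    · ext (i | i) (j | j)
      · simpa using (h₁₁ i j).symm
      · simp [toBlocks₁₂]
      · simp [toBlocks₁₂]
      · simpa [toBlocks₂₂] using congrFun (congrFun D.2 i) j
    · rintro (k | k) i <;> simp⟩
  left_inv N := by
    ext (i | i) (j | j)
    · simp [N.2.2]
    · simpa [toBlocks₁₂, N.2.2] using
        (congrFun (congrFun N.2.1 (Sum.inl i)) (Sum.inr j)).symm
    · simp [N.2.2]
    · simp [toBlocks₂₂]
  right_inv D := by simp

/-- Change of basis for a bilinear form. -/
def congruenceEquiv {ι κ R : Type*} [Fintype ι] [Fintype κ] [DecidableEq ι] [DecidableEq κ]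
    [CommRing R] (P : Matrix ι κ R) (Q : Matrix κ ι R) (hPQ : P * Q = 1) (hQP : Q * P = 1) :
    Matrix ι ι R ≃ Matrix κ κ R where
  toFun M := Pᵀ * M * P
  invFun N := Qᵀ * N * Q
  left_inv M := by
    have h : Qᵀ * Pᵀ = 1 := by rw [← transpose_mul, hPQ, transpose_one]
    calc Qᵀ * (Pᵀ * M * P) * Q = (Qᵀ * Pᵀ) * M * (P * Q) := by simp only [Matrix.mul_assoc]
      _ = M := by rw [h, hPQ, Matrix.one_mul, Matrix.mul_one]
  right_inv N := by
    have h : Pᵀ * Qᵀ = 1 := by rw [← transpose_mul, hQP, transpose_one]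
    calc Pᵀ * (Qᵀ * N * Q) * P = (Pᵀ * Qᵀ) * N * (Q * P) := by simp only [Matrix.mul_assoc]
      _ = N := by rw [h, hQP, Matrix.one_mul, Matrix.mul_one]

end Matrix

theorem Submodule.exists_basis_sum_span_inl {F E : Type*} [Field F] [AddCommGroup E] [Module F E]
    [FiniteDimensional F E] (V : Submodule F E) :
    ∃ (s : ℕ) (b : Module.Basis (Fin (Module.finrank F V) ⊕ Fin s) F E),
      Submodule.span F (Set.range fun i => b (Sum.inl i)) = V := by
  obtain ⟨W, hW⟩ := V.exists_isCompl
  refine ⟨Module.finrank F W, ((Module.finBasis F V).prod (Module.finBasis F W)).map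
    (Submodule.prodEquivOfIsCompl V W hW), ?_⟩
  have h : (fun i => (((Module.finBasis F V).prod (Module.finBasis F W)).map
      (Submodule.prodEquivOfIsCompl V W hW)) (Sum.inl i)) = V.subtype ∘ Module.finBasis F V := by
    ext i; simp
  rw [h, Set.range_comp, ← Submodule.map_span, (Module.finBasis F V).span_eq,
    Submodule.map_top, Submodule.range_subtype]

theorem TotallyIsotropic.of_le_ker {F : Type} [Field F] {n : ℕ} {M C : Matrix (Fin n) (Fin n) F}
    {V : Submodule F (Fin n → F)} (hM : M - Mᵀ = C) (hV : V ≤ LinearMap.ker M.mulVecLin) :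
    TotallyIsotropic C V := by
  intro v hv w hw
  have hv' : M *ᵥ v = 0 := hV hv
  have hw' : M *ᵥ w = 0 := hV hw
  rw [← hM, Matrix.sub_mulVec, hw', zero_sub, dotProduct_neg, Matrix.dotProduct_mulVec,
    Matrix.vecMul_transpose, hv', zero_dotProduct, neg_zero]

theorem card_CSymmetric_of_totallyIsotropic {F : Type} [Field F] [Fintype F] {n s : ℕ}
    {C : Matrix (Fin n) (Fin n) F} (hC : Cᵀ = -C) (hdiag : ∀ i, C i i = 0)
    {V : Submodule F (Fin n → F)} (hV : TotallyIsotropic C V)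
    {ι : Type} [Fintype ι] [DecidableEq ι] (b : Module.Basis (ι ⊕ Fin s) F (Fin n → F))
    (hb : Submodule.span F (Set.range fun i => b (Sum.inl i)) = V) :
    Nat.card {M : Matrix (Fin n) (Fin n) F // M - Mᵀ = C ∧ V ≤ LinearMap.ker M.mulVecLin} =
      Fintype.card F ^ (s + 1).choose 2 := by
  obtain ⟨U, rfl⟩ := Matrix.exists_sub_transpose_eq hC hdiag
  set P := (Pi.basisFun F (Fin n)).toMatrix b with hP
  set Q := b.toMatrix (Pi.basisFun F (Fin n))
  have hPQ : P * Q = 1 := Module.Basis.toMatrix_mul_toMatrix_flip _ _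
  have hQP : Q * P = 1 := Module.Basis.toMatrix_mul_toMatrix_flip _ _
  have hcol : ∀ k, P.col k = b k := fun k => by ext i; simp [hP, Module.Basis.toMatrix_apply]
  let e := Matrix.congruenceEquiv P Q hPQ hQP
  have he : ∀ M, e M = Pᵀ * M * P := fun _ => rfl
  have he_apply : ∀ M k l, e M k l = b k ⬝ᵥ M *ᵥ b l := fun M k l => by
    rw [he, Matrix.mul_assoc, ← hcol, ← hcol]
    rfl
  have he_sub : ∀ M, e M - (e M)ᵀ = e (M - Mᵀ) := fun M => by
    simp only [he, Matrix.transpose_mul, Matrix.transpose_transpose, Matrix.mul_sub,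
      Matrix.sub_mul, Matrix.mul_assoc]
  have hmem : ∀ i, b (Sum.inl i) ∈ V := fun i => hb ▸ Submodule.subset_span ⟨i, rfl⟩
  have hker : ∀ M, V ≤ LinearMap.ker M.mulVecLin ↔ ∀ k i, e M k (Sum.inl i) = 0 := by
    intro M
    constructor
    · intro h k i
      have : M *ᵥ b (Sum.inl i) = 0 := h (hmem i)
      rw [he_apply, this, dotProduct_zero]
    · intro h
      rw [← hb, Submodule.span_le]
      rintro _ ⟨i, rfl⟩
      have hMP : M * P = Qᵀ * e M := by
        rw [he, ← Matrix.mul_assoc, ← Matrix.mul_assoc, ← Matrix.transpose_mul, hPQ,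
          Matrix.transpose_one, Matrix.one_mul]
      ext j
      calc (M *ᵥ b (Sum.inl i)) j = (M * P) j (Sum.inl i) := by rw [← hcol]; rfl
        _ = 0 := by rw [hMP, Matrix.mul_apply]; simp [h]
  have h₁₁ : ∀ i j, (e U - (e U)ᵀ) (Sum.inl i) (Sum.inl j) = 0 := fun i j => by
    rw [he_sub, he_apply]
    exact hV _ (hmem i) _ (hmem j)
  have e' : {M : Matrix (Fin n) (Fin n) F // M - Mᵀ = U - Uᵀ ∧ V ≤ LinearMap.ker M.mulVecLin} ≃
      {N // N - Nᵀ = e U - (e U)ᵀ ∧ ∀ k i, N k (Sum.inl i) = 0} :=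
    e.subtypeEquiv fun M => by rw [hker, he_sub, he_sub, e.injective.eq_iff]
  rw [Nat.card_congr (e'.trans ((Matrix.vanishingColumnsEquiv (e U) h₁₁).trans
    (Matrix.subTransposeEqEquivIsSymm _))), Matrix.card_isSymm, Fintype.card_fin]

theorem choose_two_add_mul_eq (r s : ℕ) :
    (s + 1).choose 2 + (r + s) * r = (r + s) * (r + s + 1) / 2 + r * (r - 1) / 2 := by
  have h : (r + s) * (r + s + 1) / 2 = (r + s + 1).choose 2 := by
    rw [Nat.choose_two_right, Nat.add_sub_cancel, mul_comm]
  rw [h, ← Nat.choose_two_right]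
  clear h
  induction r with
  | zero => simp
  | succ r ih =>
    have h₁ : (r + 1 + s + 1).choose 2 = (r + 1 + s) + (r + s + 1).choose 2 := by
      rw [Nat.choose_succ_succ' _ 1, Nat.choose_one_right, add_right_comm r 1 s]
    have h₂ : (r + 1).choose 2 = r + r.choose 2 := by
      rw [Nat.choose_succ_succ' _ 1, Nat.choose_one_right]
    rw [h₁, h₂]
    linarith

/-- **Vanishing probability for `C`-symmetric matrices.**  Let `C` be an `n×n` alternating
matrix over a finite field with `ℓ` elements and `V` an `r`-dimensional subspace of `F_ℓ^n`.
If `V` is totally isotropic for `C`, the number of `C`-symmetric matrices `M` (i.e.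
`M - Mᵀ = C`) with `V ⊆ ker M` equals `ℓ^{n(n+1)/2 - nr + r(r-1)/2}` (stated multiplicatively
to avoid natural subtraction); otherwise there are none. -/
theorem card_CSymmetric_vanishing_on_subspace (F : Type) [Field F] [Fintype F]
    (ℓ n r : ℕ) (hℓ : Fintype.card F = ℓ) (hn : 1 ≤ n)
    (C : Matrix (Fin n) (Fin n) F) (hCalt : Cᵀ = -C) (hCdiag : ∀ i, C i i = 0)
    (V : Submodule F (Fin n → F)) (hV : Module.finrank F V = r) :
    (TotallyIsotropic C V →
      Nat.card {M : Matrix (Fin n) (Fin n) F //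
          M - Mᵀ = C ∧ V ≤ LinearMap.ker M.mulVecLin} * ℓ ^ (n * r)
        = ℓ ^ (n * (n + 1) / 2 + r * (r - 1) / 2)) ∧
    (¬ TotallyIsotropic C V →
      Nat.card {M : Matrix (Fin n) (Fin n) F //
          M - Mᵀ = C ∧ V ≤ LinearMap.ker M.mulVecLin} = 0) := by
  subst hℓ hV
  constructor
  · intro hiso
    obtain ⟨s, b, hb⟩ := V.exists_basis_sum_span_inl
    have hrank : n = Module.finrank F V + s := by
      simpa using Module.finrank_eq_card_basis b
    rw [card_CSymmetric_of_totallyIsotropic hCalt hCdiag hiso b hb, ← pow_add]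
    congr 1
    convert choose_two_add_mul_eq (Module.finrank F V) s
  · intro hiso
    have : IsEmpty {M : Matrix (Fin n) (Fin n) F //
        M - Mᵀ = C ∧ V ≤ LinearMap.ker M.mulVecLin} :=
      ⟨fun M => hiso (.of_le_ker M.2.1 M.2.2)⟩
    exact Nat.card_of_isEmpty
end

section
/- Let ℓ be a prime power, F_ℓ a finite field with ℓ elements, n ≥ 1, and let K be a fixed subspace of F_ℓ^n of dimension k. For integers r ≥ 0 and d ≥ 1, the number of r-dimensional subspaces V of F_ℓ^n with dim(V ∩ K) ≥ d is at most ℓ^{k+r−n}/(ℓ^d − 1) times the total number of r-dimensional subspaces of F_ℓ^n; that is, ℓ^n · (ℓ^d − 1) · #{V : dim V = r, dim(V ∩ K) ≥ d} ≤ ℓ^{k+r} · #{V : dim V = r}. -/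
open Matrix

section SubspaceCounting

variable {F E : Type*} [Field F] [AddCommGroup E] [Module F E]

/-- The linear automorphisms of a finite-dimensional space act transitively on nonzero vectors. -/
theorem exists_linearEquiv_apply_eq [FiniteDimensional F E] {v w : E} (hv : v ≠ 0) (hw : w ≠ 0) :
    ∃ g : E ≃ₗ[F] E, g v = w := by
  obtain ⟨g, hg⟩ := Submodule.exists_linearEquiv_restrict_eq
    ((LinearEquiv.toSpanNonzeroSingleton F E v hv).symm ≪≫ₗ
      LinearEquiv.toSpanNonzeroSingleton F E w hw)
  refine ⟨g, ?_⟩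
  have h := hg ⟨v, Submodule.mem_span_singleton_self v⟩
  have hv1 : (LinearEquiv.toSpanNonzeroSingleton F E v hv).symm
      ⟨v, Submodule.mem_span_singleton_self v⟩ = 1 := by
    rw [LinearEquiv.symm_apply_eq]
    ext
    simp
  simpa [hv1] using h.symm

/-- The number of `r`-dimensional subspaces containing a nonzero vector does not depend on the
vector. -/
theorem natCard_finrank_eq_mem_congr [FiniteDimensional F E] (r : ℕ) {v w : E}
    (hv : v ≠ 0) (hw : w ≠ 0) :
    Nat.card {V : Submodule F E // Module.finrank F V = r ∧ v ∈ V} =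
      Nat.card {V : Submodule F E // Module.finrank F V = r ∧ w ∈ V} := by
  obtain ⟨g, rfl⟩ := exists_linearEquiv_apply_eq (F := F) hv hw
  refine Nat.card_congr ((Submodule.orderIsoMapComap g).toEquiv.subtypeEquiv fun V => ?_)
  have h1 : Module.finrank F (V.map (g : E →ₗ[F] E)) = Module.finrank F V :=
    LinearEquiv.finrank_map_eq g V
  have h2 : g v ∈ V.map (g : E →ₗ[F] E) ↔ v ∈ V := by simp
  exact (and_congr (by rw [← h1]; rfl) h2.symm)

/-- A finite subspace `W` has `|F| ^ dim W - 1` nonzero vectors. -/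
theorem card_filter_mem_ne_zero [Fintype F] [Fintype E] (W : Submodule F E)
    [DecidablePred fun v : E => v ∈ W ∧ v ≠ 0] :
    (Finset.univ.filter fun v : E => v ∈ W ∧ v ≠ 0).card =
      Fintype.card F ^ Module.finrank F W - 1 := by
  classical
  have h : (Finset.univ.filter fun v : E => v ∈ W ∧ v ≠ 0) =
      (Finset.univ.filter fun v : E => v ∈ W).erase 0 := by
    ext v
    simp [and_comm]
  rw [h, Finset.card_erase_of_mem (by simp), ← Module.card_eq_pow_finrank (K := F) (V := W),
    Fintype.card_subtype]

open Classical in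
/-- Counting incidences between a finite set of subspaces and the nonzero vectors of a fixed
subspace `K` in two ways, when every nonzero vector lies in exactly `c` of the subspaces. -/
theorem sum_pow_finrank_inf_sub_one [Fintype F] [Fintype E] (S : Finset (Submodule F E))
    (K : Submodule F E) (c : ℕ) (hc : ∀ v : E, v ≠ 0 → (S.filter (v ∈ ·)).card = c) :
    ∑ V ∈ S, (Fintype.card F ^ Module.finrank F ↥(V ⊓ K) - 1) =
      (Fintype.card F ^ Module.finrank F K - 1) * c := by
  have h := Finset.sum_card_bipartiteAbove_eq_sum_card_bipartiteBelow (s := S)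
    (t := Finset.univ.filter fun v : E => v ∈ K ∧ v ≠ 0)
    (fun (V : Submodule F E) (v : E) => v ∈ V)
  rw [Finset.sum_congr rfl fun v hv => show (S.bipartiteBelow _ v).card = c from
      hc v (Finset.mem_filter.1 hv).2.2, Finset.sum_const, card_filter_mem_ne_zero, smul_eq_mul] at h
  rw [← h]
  refine Finset.sum_congr rfl fun V _ => ?_
  rw [← card_filter_mem_ne_zero, Finset.bipartiteAbove, Finset.filter_filter]
  congr 1
  ext v
  simp only [Finset.mem_filter, Finset.mem_univ, true_and, Submodule.mem_inf]
  tauto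

end SubspaceCounting

theorem mul_le_mul_of_double_count {a b q s t c : ℕ} (ha : 1 < a) (hb : 1 ≤ b) (hba : b ≤ a)
    (hq : 1 ≤ q) (hall : t * (q - 1) = (a - 1) * c) (hbad : s ≤ (b - 1) * c) :
    a * s ≤ b * q * t := by
  obtain ⟨a, rfl⟩ := Nat.exists_eq_add_of_le' ha.le
  obtain ⟨b, rfl⟩ := Nat.exists_eq_add_of_le' hb
  obtain ⟨q, rfl⟩ := Nat.exists_eq_add_of_le' hq
  simp only [Nat.add_sub_cancel] at hall hbad
  refine Nat.le_of_mul_le_mul_left (c := a) ?_ (by omega)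
  have hbq : (a + 1) * (b * q) ≤ a * ((b + 1) * (q + 1)) := by
    nlinarith [Nat.mul_le_mul_right q (show b ≤ a by omega)]
  calc a * ((a + 1) * s) ≤ a * ((a + 1) * (b * c)) := by gcongr
    _ = (a + 1) * b * (a * c) := by ring
    _ = (a + 1) * (b * q) * t := by rw [← hall]; ring
    _ ≤ a * ((b + 1) * (q + 1)) * t := by gcongr
    _ = a * ((b + 1) * (q + 1) * t) := by ring

/-- **Counting subspaces with large intersection with a fixed subspace.**
Let `K ⊆ F_ℓ^n` be a fixed subspace of dimension `k`.  For `d ≥ 1`, the number of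
`r`-dimensional subspaces `V` with `dim (V ⊓ K) ≥ d` is at most `ℓ^{k+r-n}/(ℓ^d - 1)` times
the number of all `r`-dimensional subspaces, i.e.
`ℓ^n · (ℓ^d - 1) · #{V : dim V = r, dim (V ⊓ K) ≥ d} ≤ ℓ^{k+r} · #{V : dim V = r}`. -/
theorem card_subspaces_large_intersection (F : Type) [Field F] [Fintype F]
    (ℓ n k r d : ℕ) (hℓ : Fintype.card F = ℓ) (hn : 1 ≤ n) (hd : 1 ≤ d)
    (K : Submodule F (Fin n → F)) (hK : Module.finrank F K = k) :
    ℓ ^ n * (ℓ ^ d - 1) *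
        Nat.card {V : Submodule F (Fin n → F) //
          Module.finrank F V = r ∧ d ≤ Module.finrank F ↥(V ⊓ K)}
      ≤ ℓ ^ (k + r) *
        Nat.card {V : Submodule F (Fin n → F) // Module.finrank F V = r} := by
  classical
  subst hℓ hK
  obtain ⟨m, rfl⟩ : ∃ m, n = m + 1 := ⟨n - 1, by omega⟩
  set E := Fin (m + 1) → F
  have hEn : Module.finrank F E = m + 1 := by simp [E]
  have : Finite (Submodule F E) := Finite.of_injective _ SetLike.coe_injective
  have : Fintype (Submodule F E) := Fintype.ofFinite _
  set S : Finset (Submodule F E) := Finset.univ.filter fun V => Module.finrank F V = r with hS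
  set B : Finset (Submodule F E) := S.filter fun V => d ≤ Module.finrank F ↥(V ⊓ K) with hB
  obtain ⟨e, he⟩ : ∃ e : E, e ≠ 0 := exists_ne 0
  set c := (S.filter (e ∈ ·)).card
  have hc (v : E) (hv : v ≠ 0) : (S.filter (v ∈ ·)).card = c := by
    simpa only [c, hS, Finset.filter_filter, Nat.card_eq_fintype_card, Fintype.card_subtype]
      using natCard_finrank_eq_mem_congr (F := F) r hv he
  have hall : S.card * (Fintype.card F ^ r - 1) = (Fintype.card F ^ (m + 1) - 1) * c := by
    have h := sum_pow_finrank_inf_sub_one S ⊤ c hc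
    rw [finrank_top, hEn] at h
    rw [← h, ← smul_eq_mul, ← Finset.sum_const]
    refine Finset.sum_congr rfl fun V hV => ?_
    rw [inf_top_eq, (Finset.mem_filter.1 hV).2]
  have hbad : B.card * (Fintype.card F ^ d - 1) ≤
      (Fintype.card F ^ Module.finrank F K - 1) * c := by
    rw [← sum_pow_finrank_inf_sub_one S K c hc, ← smul_eq_mul, ← Finset.sum_const]
    refine (Finset.sum_le_sum fun V hV => ?_).trans
      (Finset.sum_le_sum_of_subset (Finset.filter_subset _ S))
    exact Nat.sub_le_sub_right
      (Nat.pow_le_pow_right Fintype.card_pos (Finset.mem_filter.1 hV).2) 1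
  have hBcard : Nat.card {V : Submodule F E //
      Module.finrank F V = r ∧ d ≤ Module.finrank F ↥(V ⊓ K)} = B.card := by
    simp only [hB, hS, Finset.filter_filter, Nat.card_eq_fintype_card, Fintype.card_subtype]
  have hScard : Nat.card {V : Submodule F E // Module.finrank F V = r} = S.card := by
    simp only [hS, Nat.card_eq_fintype_card, Fintype.card_subtype]
  have hKle : Module.finrank F K ≤ m + 1 := (Submodule.finrank_le K).trans_eq hEn
  rw [hBcard, hScard, mul_assoc, mul_comm _ B.card, pow_add _ _ r]
  exact mul_le_mul_of_double_count
    (Nat.one_lt_pow (Nat.succ_ne_zero m) Fintype.one_lt_card)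
    (Nat.one_le_pow _ _ Fintype.card_pos) (Nat.pow_le_pow_right Fintype.card_pos hKle)
    (Nat.one_le_pow _ _ Fintype.card_pos) hall hbad
end

section
/- Let ℓ be a prime power, F_ℓ a finite field with ℓ elements, n ≥ 1, and let C be an n×n alternating matrix over F_ℓ of rank c. Let r ≥ 0 with 2r ≤ c. Let T be the number of r-dimensional subspaces of F_ℓ^n and I the number of r-dimensional subspaces that are totally isotropic for C. Then ℓ^{−r(r−1)/2} · ∏_{i=0}^{r−1} (1 − ℓ^{2i−n})/(1 − ℓ^{i−n}) ≤ I/T ≤ ℓ^{−r(r−1)/2} · ∏_{i=0}^{r−1} (1 − ℓ^{2i−c})/(1 − ℓ^{i−c}) + ℓ^{r−c}/(ℓ − 1). In particular, 1 − 2ℓ^{2r−1−n} ≤ (I/T) · ℓ^{r(r−1)/2} ≤ 1 + 2ℓ^{r(r+1)/2 − 1 − c}. -/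
open Matrix BigOperators

/-- The number of `r`-dimensional subspaces of `F^n`. -/
noncomputable def subspaceCount (F : Type) [Field F] (n r : ℕ) : ℕ :=
  Nat.card {V : Submodule F (Fin n → F) // Module.finrank F V = r}

/-- The number of `r`-dimensional subspaces of `F^n` that are totally isotropic for `C`. -/
noncomputable def isotropicSubspaceCount (F : Type) [Field F] {n : ℕ}
    (C : Matrix (Fin n) (Fin n) F) (r : ℕ) : ℕ :=
  Nat.card {V : Submodule F (Fin n → F) //
    Module.finrank F V = r ∧ TotallyIsotropic C V}

open Module Submodule in
/-- The preimage of the image of the span of vectors whose images are independent. -/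
lemma finrank_comap_span_range {F V W : Type*} [Field F] [AddCommGroup V] [Module F V]
    [FiniteDimensional F V] [AddCommGroup W] [Module F W] (f : V →ₗ[F] W) {k : ℕ}
    (s : Fin k → V) (hs : LinearIndependent F (f ∘ s)) :
    finrank F ((span F (Set.range (f ∘ s))).comap f) = finrank F (LinearMap.ker f) + k := by
  set N := span F (Set.range (f ∘ s)) with hN
  have h := LinearMap.finrank_range_add_finrank_ker (f.domRestrict (N.comap f))
  have hNr : N ≤ LinearMap.range f := by
    rw [hN, span_le]
    rintro _ ⟨i, rfl⟩
    exact ⟨s i, rfl⟩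
  have hr : LinearMap.range (f.domRestrict (N.comap f)) = N := by
    rw [LinearMap.range_domRestrict, map_comap_eq, inf_eq_right.mpr hNr]
  have hk : finrank F (LinearMap.ker (f.domRestrict (N.comap f))) =
      finrank F (LinearMap.ker f) := by
    rw [LinearMap.ker_domRestrict]
    exact (comapSubtypeEquivOfLe (LinearMap.ker_le_comap f)).finrank_eq
  rw [hr, hk, finrank_span_eq_card hs, Fintype.card_fin] at h
  omega

/-- Tuples of length `k + 1` built from tuples of length `k` by prepending an admissible vector. -/
def consSubtypeEquiv {V : Type*} (P : ∀ k, (Fin k → V) → Prop) (A : ∀ k, (Fin k → V) → Set V)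
    (hP : ∀ k (s : Fin k → V) x, P (k + 1) (Fin.cons x s) ↔ P k s ∧ x ∈ A k s) (k : ℕ) :
    {s : Fin (k + 1) → V // P (k + 1) s} ≃ Σ s : {s : Fin k → V // P k s}, A k s.1 where
  toFun s :=
    have h := (hP k (Fin.tail s.1) (s.1 0)).1 (by rw [Fin.cons_self_tail]; exact s.2)
    ⟨⟨Fin.tail s.1, h.1⟩, ⟨s.1 0, h.2⟩⟩
  invFun p := ⟨Fin.cons p.2.1 p.1.1, (hP k _ _).2 ⟨p.1.2, p.2.2⟩⟩
  left_inv s := by simp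
  right_inv p := by rfl

lemma prod_le_card_tuples {V : Type*} [Finite V] (P : ∀ k, (Fin k → V) → Prop)
    (A : ∀ k, (Fin k → V) → Set V) (h0 : ∀ s, P 0 s)
    (hP : ∀ k (s : Fin k → V) x, P (k + 1) (Fin.cons x s) ↔ P k s ∧ x ∈ A k s) (f : ℕ → ℕ)
    (hf : ∀ k s, P k s → f k ≤ Nat.card (A k s)) (r : ℕ) :
    ∏ i ∈ Finset.range r, f i ≤ Nat.card {s : Fin r → V // P r s} := by
  induction r with
  | zero =>
    have : Nonempty {s : Fin 0 → V // P 0 s} := ⟨⟨Fin.elim0, h0 _⟩⟩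
    simp only [Finset.range_zero, Finset.prod_empty]
    exact (Nat.card_pos (α := {s : Fin 0 → V // P 0 s}))
  | succ k ih =>
    have := Fintype.ofFinite {s : Fin k → V // P k s}
    rw [Nat.card_congr (consSubtypeEquiv P A hP k), Nat.card_sigma, Finset.prod_range_succ]
    calc (∏ i ∈ Finset.range k, f i) * f k
        ≤ Nat.card {s : Fin k → V // P k s} * f k := Nat.mul_le_mul_right _ ih
      _ = ∑ _s : {s : Fin k → V // P k s}, f k := by
          rw [Finset.sum_const, Finset.card_univ, Nat.card_eq_fintype_card, smul_eq_mul]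
      _ ≤ _ := Finset.sum_le_sum fun s _ => hf k s.1 s.2

lemma card_tuples_le_prod {V : Type*} [Finite V] (P : ∀ k, (Fin k → V) → Prop)
    (A : ∀ k, (Fin k → V) → Set V)
    (hP : ∀ k (s : Fin k → V) x, P (k + 1) (Fin.cons x s) ↔ P k s ∧ x ∈ A k s) (f : ℕ → ℕ)
    (hf : ∀ k s, P k s → Nat.card (A k s) ≤ f k) (r : ℕ) :
    Nat.card {s : Fin r → V // P r s} ≤ ∏ i ∈ Finset.range r, f i := by
  induction r with
  | zero =>
    simp only [Finset.range_zero, Finset.prod_empty]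
    exact Finite.card_le_one_iff_subsingleton.2 inferInstance
  | succ k ih =>
    have := Fintype.ofFinite {s : Fin k → V // P k s}
    rw [Nat.card_congr (consSubtypeEquiv P A hP k), Nat.card_sigma, Finset.prod_range_succ]
    calc _ ≤ ∑ _s : {s : Fin k → V // P k s}, f k :=
          Finset.sum_le_sum fun s _ => hf k s.1 s.2
      _ = Nat.card {s : Fin k → V // P k s} * f k := by
          rw [Finset.sum_const, Finset.card_univ, Nat.card_eq_fintype_card, smul_eq_mul]
      _ ≤ _ := Nat.mul_le_mul_right _ ih

lemma linearIndependent_comp_finCons {F V W : Type*} [Field F] [AddCommGroup V] [Module F V]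
    [AddCommGroup W] [Module F W] (f : V →ₗ[F] W) {k : ℕ} (s : Fin k → V) (x : V) :
    LinearIndependent F (f ∘ (Fin.cons x s : Fin (k + 1) → V)) ↔
      LinearIndependent F (f ∘ s) ∧ x ∉ (Submodule.span F (Set.range (f ∘ s))).comap f := by
  rw [Fin.comp_cons f x s, linearIndependent_finCons]
  rfl

lemma finrank_ker_mulVecLin {F : Type*} [Field F] {m n : ℕ} (M : Matrix (Fin m) (Fin n) F) :
    Module.finrank F (LinearMap.ker M.mulVecLin) = n - M.rank := by
  have := LinearMap.finrank_range_add_finrank_ker M.mulVecLin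
  rw [Module.finrank_fin_fun] at this
  unfold Matrix.rank
  omega

lemma dotProduct_mulVec_self_eq_zero {F : Type*} [CommRing F] {n : ℕ}
    {C : Matrix (Fin n) (Fin n) F} (hCalt : Cᵀ = -C) (hCdiag : ∀ i, C i i = 0) (v : Fin n → F) :
    v ⬝ᵥ C.mulVec v = 0 := by
  simp only [dotProduct, mulVec, Finset.mul_sum]
  rw [← Finset.sum_product']
  refine Finset.sum_involution (fun p _ => p.swap) ?_ ?_ (by simp) (by simp)
  · rintro ⟨i, j⟩ -
    have : C j i = - C i j := congrFun (congrFun hCalt i) j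
    simp only [Prod.swap, this]
    ring
  · rintro ⟨i, j⟩ - h e
    simp only [Prod.swap, Prod.mk.injEq] at e
    rw [e.1] at h
    simp [hCdiag] at h

lemma dotProduct_mulVec_swap {F : Type*} [CommRing F] {n : ℕ}
    {C : Matrix (Fin n) (Fin n) F} (hCalt : Cᵀ = -C) (v w : Fin n → F) :
    v ⬝ᵥ C.mulVec w = -(w ⬝ᵥ C.mulVec v) := by
  rw [dotProduct_mulVec, ← mulVec_transpose, hCalt, neg_mulVec, neg_dotProduct, dotProduct_comm]

/-- The matrix whose kernel is the orthogonal of the family `s` with respect to `C`. -/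
def orthogonalMatrix {F : Type*} [CommRing F] {n k : ℕ} (C : Matrix (Fin n) (Fin n) F)
    (s : Fin k → Fin n → F) : Matrix (Fin k) (Fin n) F :=
  Matrix.of fun i => s i ᵥ* C

lemma mem_ker_orthogonalMatrix {F : Type*} [CommRing F] {n k : ℕ} {C : Matrix (Fin n) (Fin n) F}
    {s : Fin k → Fin n → F} {x : Fin n → F} :
    x ∈ LinearMap.ker (orthogonalMatrix C s).mulVecLin ↔ ∀ i, s i ⬝ᵥ C *ᵥ x = 0 := by
  rw [LinearMap.mem_ker, funext_iff]
  refine forall_congr' fun i => ?_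
  rw [dotProduct_mulVec]
  rfl

lemma rank_orthogonalMatrix {F : Type*} [Field F] {n k : ℕ} {C : Matrix (Fin n) (Fin n) F}
    (hCalt : Cᵀ = -C) {s : Fin k → Fin n → F} (hs : LinearIndependent F (C.mulVecLin ∘ s)) :
    (orthogonalMatrix C s).rank = k := by
  have : LinearIndependent F (orthogonalMatrix C s).row := by
    have h : (orthogonalMatrix C s).row = fun i => (-1 : Fˣ) • (C.mulVecLin ∘ s) i := by
      funext i
      change s i ᵥ* C = (-1 : Fˣ) • (C *ᵥ s i)
      rw [← mulVec_transpose, hCalt, neg_mulVec]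
      simp
    rw [h]
    exact hs.units_smul (fun _ => -1)
  simpa using this.rank_matrix

/-- The members of `s` are pairwise orthogonal for `C`. -/
def IsotropicFamily {F : Type*} [CommRing F] {n k : ℕ} (C : Matrix (Fin n) (Fin n) F)
    (s : Fin k → Fin n → F) : Prop :=
  ∀ i j, s i ⬝ᵥ C *ᵥ s j = 0

lemma isotropicFamily_cons {F : Type*} [CommRing F] {n k : ℕ} {C : Matrix (Fin n) (Fin n) F}
    (hCalt : Cᵀ = -C) (hCdiag : ∀ i, C i i = 0) (s : Fin k → Fin n → F) (x : Fin n → F) :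
    IsotropicFamily C (Fin.cons x s : Fin (k + 1) → Fin n → F) ↔
      IsotropicFamily C s ∧ x ∈ LinearMap.ker (orthogonalMatrix C s).mulVecLin := by
  rw [mem_ker_orthogonalMatrix]
  constructor
  · intro h
    exact ⟨fun i j => by simpa using h i.succ j.succ, fun i => by simpa using h i.succ 0⟩
  · rintro ⟨h, hx⟩ i j
    refine Fin.cases ?_ (fun i => ?_) i <;> refine Fin.cases ?_ (fun j => ?_) j
    · simpa using dotProduct_mulVec_self_eq_zero hCalt hCdiag x
    · simpa [hx j] using dotProduct_mulVec_swap hCalt x (s j)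
    · simpa using hx i
    · simpa using h i j

lemma totallyIsotropic_span_range {F : Type} [CommRing F] {n k : ℕ}
    {C : Matrix (Fin n) (Fin n) F} (s : Fin k → Fin n → F) :
    TotallyIsotropic C (Submodule.span F (Set.range s)) ↔ IsotropicFamily C s := by
  constructor
  · intro h i j
    exact h _ (Submodule.subset_span ⟨i, rfl⟩) _ (Submodule.subset_span ⟨j, rfl⟩)
  · intro h v hv w hw
    induction hv, hw using Submodule.span_induction₂ with
    | mem_mem x y hx hy =>
      obtain ⟨i, rfl⟩ := hx
      obtain ⟨j, rfl⟩ := hy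
      exact h i j
    | zero_left => simp
    | zero_right => simp
    | add_left => simp_all [add_dotProduct]
    | add_right => simp_all [mulVec_add, dotProduct_add]
    | smul_left => simp_all
    | smul_right => simp_all [mulVec_smul]

lemma span_range_coe_eq {F : Type*} [Field F] {n r : ℕ} {W : Submodule F (Fin n → F)}
    (hW : Module.finrank F W = r)
    {t : Fin r → W} (ht : LinearIndependent F t) :
    Submodule.span F (Set.range fun i => (t i : Fin n → F)) = W := by
  have h := ht.span_eq_top_of_card_eq_finrank' (by rw [Fintype.card_fin, hW])
  have h2 := congrArg (Submodule.map W.subtype) h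
  rw [Submodule.map_span, ← Set.range_comp, Submodule.map_subtype_top] at h2
  exact h2

section Counting

variable {F : Type} [Field F] [Fintype F] {n : ℕ}

local notation "q" => Fintype.card F

lemma card_submodule_fin (W : Submodule F (Fin n → F)) :
    Nat.card W = q ^ Module.finrank F W := by
  rw [Module.natCard_eq_pow_finrank (K := F), Nat.card_eq_fintype_card]

lemma card_independent_ge (f : (Fin n → F) →ₗ[F] (Fin n → F)) (r : ℕ) :
    ∏ i ∈ Finset.range r, (q ^ n - q ^ (Module.finrank F (LinearMap.ker f) + i)) ≤
      Nat.card {s : Fin r → Fin n → F // LinearIndependent F (f ∘ s)} := by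
  refine prod_le_card_tuples (fun k s => LinearIndependent F (f ∘ s))
    (fun k s => {x | x ∉ (Submodule.span F (Set.range (f ∘ s))).comap f})
    (fun s => linearIndependent_empty_type) (fun k s x => linearIndependent_comp_finCons f s x)
    _ (fun k s hs => ?_) r
  have h := card_submodule_fin ((Submodule.span F (Set.range (f ∘ s))).comap f)
  rw [finrank_comap_span_range f s hs] at h
  rw [← h]
  have h2 := Set.ncard_compl (((Submodule.span F (Set.range (f ∘ s))).comap f : Set (Fin n → F)))
  rw [Nat.card_eq_fintype_card (α := Fin n → F), Fintype.card_fun, Fintype.card_fin] at h2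
  exact h2.ge

lemma card_isotropic_independent_ge {C : Matrix (Fin n) (Fin n) F} (hCalt : Cᵀ = -C)
    (hCdiag : ∀ i, C i i = 0) (r : ℕ) :
    ∏ i ∈ Finset.range r, (q ^ (n - i) - q ^ i) ≤
      Nat.card {s : Fin r → Fin n → F // LinearIndependent F s ∧ IsotropicFamily C s} := by
  refine prod_le_card_tuples (fun k s => LinearIndependent F s ∧ IsotropicFamily C s)
    (fun k s => (LinearMap.ker (orthogonalMatrix C s).mulVecLin : Set (Fin n → F)) \
      (Submodule.span F (Set.range s)))
    (fun s => ⟨linearIndependent_empty_type, fun i => i.elim0⟩) (fun k s x => ?_)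
    _ (fun k s hs => ?_) r
  · rw [linearIndependent_finCons, isotropicFamily_cons hCalt hCdiag]
    simp only [Set.mem_sdiff, SetLike.mem_coe]
    tauto
  · have h1 := card_submodule_fin (LinearMap.ker (orthogonalMatrix C s).mulVecLin)
    have h2 := card_submodule_fin (Submodule.span F (Set.range s))
    rw [finrank_span_eq_card hs.1, Fintype.card_fin] at h2
    rw [finrank_ker_mulVecLin] at h1
    have h3 := Set.le_ncard_sdiff (Submodule.span F (Set.range s) : Set (Fin n → F))
      (LinearMap.ker (orthogonalMatrix C s).mulVecLin : Set (Fin n → F))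
    have h4 : (orthogonalMatrix C s).rank ≤ k := by
      simpa using (orthogonalMatrix C s).rank_le_height
    refine le_trans ?_ h3
    change _ ≤ Nat.card (LinearMap.ker (orthogonalMatrix C s).mulVecLin) -
      Nat.card (Submodule.span F (Set.range s))
    rw [h1, h2]
    exact Nat.sub_le_sub_right (Nat.pow_le_pow_right Fintype.card_pos (by omega)) _

lemma card_isotropic_independent_le {C : Matrix (Fin n) (Fin n) F} (hCalt : Cᵀ = -C)
    (hCdiag : ∀ i, C i i = 0) (r : ℕ) :
    Nat.card {s : Fin r → Fin n → F //
        LinearIndependent F (C.mulVecLin ∘ s) ∧ IsotropicFamily C s} ≤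
      ∏ i ∈ Finset.range r, (q ^ (n - i) - q ^ (n - C.rank + i)) := by
  refine card_tuples_le_prod
    (fun k s => LinearIndependent F (C.mulVecLin ∘ s) ∧ IsotropicFamily C s)
    (fun k s => (LinearMap.ker (orthogonalMatrix C s).mulVecLin : Set (Fin n → F)) \
      ((Submodule.span F (Set.range (C.mulVecLin ∘ s))).comap C.mulVecLin))
    (fun k s x => ?_)
    _ (fun k s hs => ?_) r
  · rw [linearIndependent_comp_finCons, isotropicFamily_cons hCalt hCdiag]
    simp only [Set.mem_sdiff, SetLike.mem_coe]
    tauto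
  · have h1 := card_submodule_fin (LinearMap.ker (orthogonalMatrix C s).mulVecLin)
    have h2 := card_submodule_fin
      ((Submodule.span F (Set.range (C.mulVecLin ∘ s))).comap C.mulVecLin)
    rw [finrank_comap_span_range _ s hs.1, finrank_ker_mulVecLin] at h2
    rw [finrank_ker_mulVecLin, rank_orthogonalMatrix hCalt hs.1] at h1
    have hle : (Submodule.span F (Set.range (C.mulVecLin ∘ s))).comap C.mulVecLin ≤
        LinearMap.ker (orthogonalMatrix C s).mulVecLin := by
      intro x hx
      rw [mem_ker_orthogonalMatrix]
      intro i
      rw [Submodule.mem_comap] at hx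
      change C *ᵥ x ∈ _ at hx
      generalize C *ᵥ x = y at hx
      induction hx using Submodule.span_induction with
      | mem y hy =>
        obtain ⟨j, rfl⟩ := hy
        exact hs.2 i j
      | zero => simp
      | add => simp_all [dotProduct_add]
      | smul => simp_all
    rw [← h1, ← h2]
    exact (Set.ncard_sdiff (SetLike.coe_subset_coe.2 hle)).le

/-- An independent family is the same as an ordered basis of its span. -/
noncomputable def sigmaBasisEquiv {r : ℕ} (P : Submodule F (Fin n → F) → Prop) :
    (Σ W : {W : Submodule F (Fin n → F) // Module.finrank F W = r ∧ P W},
        {t : Fin r → W.1 // LinearIndependent F t}) ≃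
      {s : Fin r → Fin n → F // LinearIndependent F s ∧ P (Submodule.span F (Set.range s))} :=
  Equiv.ofBijective
    (fun p => ⟨fun i => (p.2.1 i : Fin n → F),
      p.2.2.map' (Submodule.subtype _) (Submodule.ker_subtype _), by
        rw [span_range_coe_eq p.1.2.1 p.2.2]
        exact p.1.2.2⟩) <| by
    constructor
    · rintro ⟨⟨W, hW⟩, ⟨t, ht⟩⟩ ⟨⟨W', hW'⟩, ⟨t', ht'⟩⟩ h
      have h : (fun i => (t i : Fin n → F)) = fun i => (t' i : Fin n → F) := congrArg Subtype.val h
      obtain rfl : W = W' := by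
        rw [← span_range_coe_eq hW.1 ht, ← span_range_coe_eq hW'.1 ht', h]
      obtain rfl : t = t' := funext fun i => Subtype.ext (congrFun h i)
      rfl
    · rintro ⟨s, hs, hP⟩
      exact ⟨⟨⟨Submodule.span F (Set.range s), by
          rw [finrank_span_eq_card hs, Fintype.card_fin], hP⟩,
        ⟨fun i => ⟨s i, Submodule.subset_span ⟨i, rfl⟩⟩,
          LinearIndependent.of_comp (Submodule.subtype _) hs⟩⟩, rfl⟩

lemma card_independent_span {r : ℕ} (P : Submodule F (Fin n → F) → Prop) :
    Nat.card {s : Fin r → Fin n → F //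
        LinearIndependent F s ∧ P (Submodule.span F (Set.range s))} =
      Nat.card {W : Submodule F (Fin n → F) // Module.finrank F W = r ∧ P W} *
        ∏ i : Fin r, (q ^ r - q ^ i.val) := by
  have := Fintype.ofFinite {W : Submodule F (Fin n → F) // Module.finrank F W = r ∧ P W}
  rw [← Nat.card_congr (sigmaBasisEquiv P), Nat.card_sigma]
  rw [Nat.card_eq_fintype_card, ← smul_eq_mul, ← Finset.card_univ]
  refine Finset.sum_eq_card_nsmul fun W _ => ?_
  rw [card_linearIndependent W.2.1.ge, W.2.1]

end Counting

section Bounds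

variable {Q : ℝ}

lemma one_sub_sum_le_prod_one_sub (f : ℕ → ℝ) (r : ℕ) (h0 : ∀ i < r, 0 ≤ f i)
    (h1 : ∀ i < r, f i ≤ 1) :
    1 - ∑ i ∈ Finset.range r, f i ≤ ∏ i ∈ Finset.range r, (1 - f i) := by
  induction r with
  | zero => simp
  | succ k ih =>
    have ih := ih (fun i hi => h0 i (by omega)) (fun i hi => h1 i (by omega))
    rw [Finset.sum_range_succ, Finset.prod_range_succ]
    have hs : 0 ≤ ∑ i ∈ Finset.range k, f i :=
      Finset.sum_nonneg fun i hi => h0 i (by have := Finset.mem_range.1 hi; omega)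
    have := mul_le_mul_of_nonneg_right ih (sub_nonneg.2 (h1 k (by omega)))
    nlinarith [h0 k (by omega)]

lemma prod_zpow_neg (r : ℕ) :
    ∏ i ∈ Finset.range r, Q ^ (-(i : ℤ)) = Q ^ (-((r * (r - 1) / 2 : ℕ) : ℤ)) := by
  simp only [_root_.zpow_neg, zpow_natCast, Finset.prod_inv_distrib]
  rw [Finset.prod_pow_eq_pow_sum, Finset.sum_range_id]

lemma pow_sub_pow_eq_zpow (hQ : Q ≠ 0) {n c i : ℕ} (hc : c ≤ n) :
    Q ^ n - Q ^ (n - c + i) = Q ^ n * (1 - Q ^ ((i : ℤ) - c)) := by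
  rw [mul_sub, mul_one, ← zpow_natCast, ← zpow_natCast, ← zpow_add₀ hQ]
  congr 2
  push_cast [hc]
  ring

lemma pow_sub_sub_pow_eq_zpow (hQ : Q ≠ 0) {n c i : ℕ} (hc : c ≤ n) (hi : i ≤ n) :
    Q ^ (n - i) - Q ^ (n - c + i) =
      Q ^ n * (Q ^ (-(i : ℤ)) * (1 - Q ^ (2 * (i : ℤ) - c))) := by
  rw [mul_sub, mul_one, mul_sub, ← zpow_add₀ hQ, ← zpow_natCast Q n, ← zpow_add₀ hQ,
    ← zpow_add₀ hQ, ← zpow_natCast, ← zpow_natCast]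
  congr 2 <;> · push_cast [hc, hi]; ring

lemma prod_ratio_eq (hQ : Q ≠ 0) {n c r : ℕ} (hc : c ≤ n) (hr : r ≤ n) :
    (∏ i ∈ Finset.range r, (Q ^ (n - i) - Q ^ (n - c + i))) /
        ∏ i ∈ Finset.range r, (Q ^ n - Q ^ (n - c + i)) =
      Q ^ (-((r * (r - 1) / 2 : ℕ) : ℤ)) *
        ∏ i ∈ Finset.range r, (1 - Q ^ (2 * (i : ℤ) - c)) / (1 - Q ^ ((i : ℤ) - c)) := by
  rw [← prod_zpow_neg, ← Finset.prod_mul_distrib, ← Finset.prod_div_distrib]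
  refine Finset.prod_congr rfl fun i hi => ?_
  have hi := Finset.mem_range.1 hi
  rw [pow_sub_pow_eq_zpow hQ hc, pow_sub_sub_pow_eq_zpow hQ hc (by omega),
    mul_div_mul_left _ _ (pow_ne_zero n hQ), mul_div_assoc]

lemma one_sub_zpow_pos (hQ : 1 < Q) {a : ℤ} (ha : a < 0) : 0 < 1 - Q ^ a :=
  sub_pos.2 (zpow_lt_one_of_neg₀ hQ ha)

lemma sum_zpow_sub_le (hQ : 1 < Q) (r c : ℕ) :
    ∑ i ∈ Finset.range r, Q ^ ((i : ℤ) - c) ≤ Q ^ ((r : ℤ) - c) / (Q - 1) := by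
  have hQ0 : Q ≠ 0 := by positivity
  simp only [zpow_sub₀ hQ0, zpow_natCast, ← Finset.sum_div]
  rw [geom_sum_eq hQ.ne', div_right_comm]
  gcongr
  linarith

/-- The proportion of independent families that stay independent modulo the radical. -/
lemma one_sub_prod_ratio_le (hQ : 1 < Q) {n c r : ℕ} (hc : c ≤ n) (hr : r ≤ c) :
    1 - (∏ i ∈ Finset.range r, (Q ^ n - Q ^ (n - c + i))) /
        ∏ i ∈ Finset.range r, (Q ^ n - Q ^ i) ≤ Q ^ ((r : ℤ) - c) / (Q - 1) := by
  have hQ0 : Q ≠ 0 := by positivity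
  refine le_trans ?_ (sum_zpow_sub_le hQ r c)
  rw [sub_le_comm]
  refine (one_sub_sum_le_prod_one_sub _ r (fun i _ => by positivity)
    (fun i hi => zpow_le_one_of_nonpos₀ hQ.le (by omega))).trans ?_
  rw [← Finset.prod_div_distrib]
  refine Finset.prod_le_prod (fun i hi => ?_) (fun i hi => ?_)
  all_goals have hi := Finset.mem_range.1 hi
  · exact (one_sub_zpow_pos hQ (by omega)).le
  · rw [pow_sub_pow_eq_zpow hQ0 hc, mul_comm, mul_div_assoc]
    refine le_mul_of_one_le_right (one_sub_zpow_pos hQ (by omega)).le ?_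
    rw [one_le_div (sub_pos.2 (pow_lt_pow_right₀ hQ (by omega)))]
    have : 0 < Q ^ i := by positivity
    linarith

lemma prod_ratio_le_one (hQ : 1 < Q) {c r : ℕ} (hr : 2 * r ≤ c) :
    ∏ i ∈ Finset.range r, (1 - Q ^ (2 * (i : ℤ) - c)) / (1 - Q ^ ((i : ℤ) - c)) ≤ 1 := by
  refine Finset.prod_le_one (fun i hi => ?_) (fun i hi => ?_)
  all_goals have hi := Finset.mem_range.1 hi
  · exact div_nonneg (one_sub_zpow_pos hQ (by omega)).le (one_sub_zpow_pos hQ (by omega)).le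
  · rw [div_le_one (one_sub_zpow_pos hQ (by omega))]
    exact sub_le_sub_left (zpow_le_zpow_right₀ hQ.le (by omega)) _

lemma le_prod_ratio (hQ : 2 ≤ Q) {n r : ℕ} (hr : 2 * r ≤ n) :
    1 - 2 * Q ^ (2 * (r : ℤ) - 1 - n) ≤
      ∏ i ∈ Finset.range r, (1 - Q ^ (2 * (i : ℤ) - n)) / (1 - Q ^ ((i : ℤ) - n)) := by
  have hQ1 : 1 < Q := by linarith
  have hQ0 : Q ≠ 0 := by positivity
  have h1 : ∏ i ∈ Finset.range r, (1 - Q ^ (2 * (i : ℤ) - n)) ≤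
      ∏ i ∈ Finset.range r, (1 - Q ^ (2 * (i : ℤ) - n)) / (1 - Q ^ ((i : ℤ) - n)) := by
    refine Finset.prod_le_prod (fun i hi => ?_) (fun i hi => ?_)
    all_goals have hi := Finset.mem_range.1 hi
    · exact (one_sub_zpow_pos hQ1 (by omega)).le
    · refine le_div_self (one_sub_zpow_pos hQ1 (by omega)).le
        (one_sub_zpow_pos hQ1 (by omega)) ?_
      have : 0 < Q ^ ((i : ℤ) - n) := by positivity
      linarith
  refine le_trans ?_ h1
  refine le_trans ?_ (one_sub_sum_le_prod_one_sub _ r (fun i _ => by positivity)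
    (fun i hi => zpow_le_one_of_nonpos₀ hQ1.le (by omega)))
  refine sub_le_sub_left ?_ _
  clear h1 hr
  induction r with
  | zero => simp; positivity
  | succ k ih =>
    rw [Finset.sum_range_succ]
    have e1 : Q ^ (2 * (k : ℤ) - n) = Q ^ (2 * (k : ℤ) - 1 - n) * Q := by
      rw [← zpow_add_one₀ hQ0]; congr 1; ring
    have e2 : Q ^ (2 * ((k + 1 : ℕ) : ℤ) - 1 - n) = Q ^ (2 * (k : ℤ) - 1 - n) * Q * Q := by
      rw [← zpow_add_one₀ hQ0, ← zpow_add_one₀ hQ0]; congr 1; push_cast; ring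
    rw [e2, e1]
    have hp : 0 < Q ^ (2 * (k : ℤ) - 1 - n) := by positivity
    nlinarith [mul_nonneg hp.le (show (0:ℝ) ≤ 2 * Q * Q - 2 - Q by nlinarith)]

end Bounds

lemma cast_prod_pow_sub_pow {q r : ℕ} (hq : 1 ≤ q) (a b : ℕ → ℕ) (h : ∀ i < r, b i ≤ a i) :
    ((∏ i ∈ Finset.range r, (q ^ a i - q ^ b i) : ℕ) : ℝ) =
      ∏ i ∈ Finset.range r, ((q : ℝ) ^ a i - (q : ℝ) ^ b i) := by
  rw [Nat.cast_prod]
  refine Finset.prod_congr rfl fun i hi => ?_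
  rw [Nat.cast_sub (Nat.pow_le_pow_right hq (h i (Finset.mem_range.1 hi)))]
  push_cast
  rfl

lemma card_isotropic_add_card_le {F : Type} [Field F] [Fintype F] {n : ℕ}
    (C : Matrix (Fin n) (Fin n) F) (r : ℕ) :
    Nat.card {s : Fin r → Fin n → F // LinearIndependent F s ∧ IsotropicFamily C s} +
        Nat.card {s : Fin r → Fin n → F // LinearIndependent F (C.mulVecLin ∘ s)} ≤
      Nat.card {s : Fin r → Fin n → F // LinearIndependent F s} +
        Nat.card {s : Fin r → Fin n → F //
          LinearIndependent F (C.mulVecLin ∘ s) ∧ IsotropicFamily C s} := by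
  have h := Set.ncard_union_add_ncard_inter
    {s : Fin r → Fin n → F | LinearIndependent F s ∧ IsotropicFamily C s}
    {s : Fin r → Fin n → F | LinearIndependent F (C.mulVecLin ∘ s)}
  refine h.ge.trans (Nat.add_le_add (Set.ncard_le_ncard ?_) (Set.ncard_le_ncard ?_))
  · rintro s (hs | hs)
    · exact hs.1
    · exact LinearIndependent.of_comp _ hs
  · exact fun s hs => ⟨hs.2, hs.1.2⟩

/-- The proportion of isotropic subspaces is the proportion of isotropic independent families. -/
lemma isotropic_ratio_eq {F : Type} [Field F] [Fintype F] {n : ℕ}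
    (C : Matrix (Fin n) (Fin n) F) {r : ℕ} (hr : r ≤ n) :
    (isotropicSubspaceCount F C r : ℝ) / (subspaceCount F n r : ℝ) =
      (Nat.card {s : Fin r → Fin n → F // LinearIndependent F s ∧ IsotropicFamily C s} : ℝ) /
        ∏ i ∈ Finset.range r, ((Fintype.card F : ℝ) ^ n - (Fintype.card F : ℝ) ^ i) := by
  have h1 := card_independent_span (n := n) (r := r) (TotallyIsotropic C)
  have h2 := card_independent_span (F := F) (n := n) (r := r) (fun _ => True)
  simp only [totallyIsotropic_span_range] at h1
  simp only [and_true] at h2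
  rw [card_linearIndependent (by rwa [Module.finrank_fin_fun]), Module.finrank_fin_fun] at h2
  have hK : ((∏ i : Fin r, (Fintype.card F ^ r - Fintype.card F ^ i.val) : ℕ) : ℝ) ≠ 0 := by
    rw [Nat.cast_ne_zero, Finset.prod_ne_zero_iff]
    exact fun i _ => (Nat.sub_pos_of_lt (Nat.pow_lt_pow_right Fintype.one_lt_card i.2)).ne'
  rw [← cast_prod_pow_sub_pow Fintype.card_pos (fun _ => n) (fun i => i)
    (fun i hi => by omega), ← Fin.prod_univ_eq_prod_range
    (fun i => Fintype.card F ^ n - Fintype.card F ^ i), h1, h2, Nat.cast_mul, Nat.cast_mul,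
    mul_div_mul_right _ _ hK]
  rfl

/-- **Probability that a random subspace is totally isotropic.**  Let `C` be an `n×n`
alternating matrix of rank `c` over a finite field with `ℓ` elements and `2r ≤ c`.  With `T`
the number of `r`-dimensional subspaces and `I` the number of totally isotropic ones,
`ℓ^{-r(r-1)/2} ∏_{i<r} (1-ℓ^{2i-n})/(1-ℓ^{i-n}) ≤ I/T ≤
 ℓ^{-r(r-1)/2} ∏_{i<r} (1-ℓ^{2i-c})/(1-ℓ^{i-c}) + ℓ^{r-c}/(ℓ-1)`,
and in particular `1 - 2ℓ^{2r-1-n} ≤ (I/T)·ℓ^{r(r-1)/2} ≤ 1 + 2ℓ^{r(r+1)/2-1-c}`. -/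
theorem isotropic_probability_bounds (F : Type) [Field F] [Fintype F]
    (ℓ n c r : ℕ) (hℓ : Fintype.card F = ℓ) (hn : 1 ≤ n)
    (C : Matrix (Fin n) (Fin n) F) (hCalt : Cᵀ = -C) (hCdiag : ∀ i, C i i = 0)
    (hc : C.rank = c) (hrc : 2 * r ≤ c) :
    ((ℓ : ℝ) ^ (-((r * (r - 1) / 2 : ℕ) : ℤ)) *
        ∏ i ∈ Finset.range r,
          (1 - (ℓ : ℝ) ^ (2 * (i : ℤ) - n)) / (1 - (ℓ : ℝ) ^ ((i : ℤ) - n))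
      ≤ (isotropicSubspaceCount F C r : ℝ) / (subspaceCount F n r : ℝ)) ∧
    ((isotropicSubspaceCount F C r : ℝ) / (subspaceCount F n r : ℝ)
      ≤ (ℓ : ℝ) ^ (-((r * (r - 1) / 2 : ℕ) : ℤ)) *
          ∏ i ∈ Finset.range r,
            (1 - (ℓ : ℝ) ^ (2 * (i : ℤ) - c)) / (1 - (ℓ : ℝ) ^ ((i : ℤ) - c))
        + (ℓ : ℝ) ^ ((r : ℤ) - c) / ((ℓ : ℝ) - 1)) ∧
    (1 - 2 * (ℓ : ℝ) ^ (2 * (r : ℤ) - 1 - n)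
      ≤ (isotropicSubspaceCount F C r : ℝ) / (subspaceCount F n r : ℝ) *
          (ℓ : ℝ) ^ ((r * (r - 1) / 2 : ℕ) : ℤ)) ∧
    ((isotropicSubspaceCount F C r : ℝ) / (subspaceCount F n r : ℝ) *
          (ℓ : ℝ) ^ ((r * (r - 1) / 2 : ℕ) : ℤ)
      ≤ 1 + 2 * (ℓ : ℝ) ^ (((r * (r + 1) / 2 : ℕ) : ℤ) - 1 - c)) := by
  subst hℓ hc
  have hcn : C.rank ≤ n := by simpa using C.rank_le_height
  have hone : 1 < Fintype.card F := Fintype.one_lt_card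
  have hiso := isotropic_ratio_eq C (r := r) (by omega)
  have hL := card_isotropic_independent_ge hCalt hCdiag r
  have hX := card_isotropic_independent_le hCalt hCdiag r
  have hG := card_independent_ge C.mulVecLin r
  have hIG := card_isotropic_add_card_le C r
  rw [finrank_ker_mulVecLin] at hG
  rw [card_linearIndependent (by rw [Module.finrank_fin_fun]; omega), Module.finrank_fin_fun,
    Fin.prod_univ_eq_prod_range (fun i => Fintype.card F ^ n - Fintype.card F ^ i)] at hIG
  generalize Nat.card {s : Fin r → Fin n → F //
    LinearIndependent F s ∧ IsotropicFamily C s} = I at *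
  generalize (isotropicSubspaceCount F C r : ℝ) / (subspaceCount F n r : ℝ) = p at *
  generalize C.rank = c at *
  have hQ : (2 : ℝ) ≤ Fintype.card F := by exact_mod_cast hone
  have hL' : ((_ : ℕ) : ℝ) ≤ I := Nat.cast_le.2 hL
  have hU' : ((_ + _ : ℕ) : ℝ) ≤ ((_ + _ : ℕ) : ℝ) :=
    Nat.cast_le.2 ((Nat.add_le_add_left hG I).trans (hIG.trans (Nat.add_le_add_left hX _)))
  rw [cast_prod_pow_sub_pow hone.le (fun i => n - i) (fun i => i) (by omega)] at hL'
  rw [Nat.cast_add, Nat.cast_add,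
    cast_prod_pow_sub_pow hone.le (fun _ => n) (fun i => n - c + i) (by omega),
    cast_prod_pow_sub_pow hone.le (fun _ => n) (fun i => i) (by omega),
    cast_prod_pow_sub_pow hone.le (fun i => n - i) (fun i => n - c + i) (by omega)] at hU'
  generalize (Fintype.card F : ℝ) = Q at *
  have hQ1 : 1 < Q := by linarith
  have hQ0 : Q ≠ 0 := by positivity
  have hT : 0 < ∏ i ∈ Finset.range r, (Q ^ n - Q ^ i) := Finset.prod_pos fun i hi =>
    sub_pos.2 (pow_lt_pow_right₀ hQ1 (by have := Finset.mem_range.1 hi; omega))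
  have hlow : Q ^ (-((r * (r - 1) / 2 : ℕ) : ℤ)) * ∏ i ∈ Finset.range r,
      (1 - Q ^ (2 * (i : ℤ) - n)) / (1 - Q ^ ((i : ℤ) - n)) ≤ p := by
    rw [← prod_ratio_eq hQ0 le_rfl (by omega), hiso]
    simp only [Nat.sub_self, Nat.zero_add]
    gcongr
  have hup : p ≤ Q ^ (-((r * (r - 1) / 2 : ℕ) : ℤ)) * ∏ i ∈ Finset.range r,
      (1 - Q ^ (2 * (i : ℤ) - c)) / (1 - Q ^ ((i : ℤ) - c)) + Q ^ ((r : ℤ) - c) / (Q - 1) := by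
    refine le_trans ?_ (add_le_add (prod_ratio_eq hQ0 hcn (by omega)).le
      (one_sub_prod_ratio_le hQ1 hcn (by omega)))
    have hGpos : 0 < ∏ i ∈ Finset.range r, (Q ^ n - Q ^ (n - c + i)) :=
      Finset.prod_pos fun i hi =>
        sub_pos.2 (pow_lt_pow_right₀ hQ1 (by have := Finset.mem_range.1 hi; omega))
    have hXnonneg : 0 ≤ ∏ i ∈ Finset.range r, (Q ^ (n - i) - Q ^ (n - c + i)) :=
      Finset.prod_nonneg fun i hi =>
        sub_nonneg.2 (pow_le_pow_right₀ hQ1.le (by have := Finset.mem_range.1 hi; omega))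
    have hGT : ∏ i ∈ Finset.range r, (Q ^ n - Q ^ (n - c + i)) ≤
        ∏ i ∈ Finset.range r, (Q ^ n - Q ^ i) := by
      refine Finset.prod_le_prod (fun i hi => ?_) (fun i hi => ?_)
      · exact sub_nonneg.2 (pow_le_pow_right₀ hQ1.le (by have := Finset.mem_range.1 hi; omega))
      · exact sub_le_sub_left (pow_le_pow_right₀ hQ1.le (by omega)) _
    have hXGT := div_le_div_of_nonneg_left hXnonneg hGpos hGT
    have := div_le_div_of_nonneg_right (le_sub_iff_add_le.2 hU') hT.le
    rw [sub_div, add_div, div_self hT.ne'] at this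
    rw [hiso]
    linarith
  have hpos : 0 < Q ^ ((r * (r - 1) / 2 : ℕ) : ℤ) := by positivity
  have hcancel : Q ^ (-((r * (r - 1) / 2 : ℕ) : ℤ)) * Q ^ ((r * (r - 1) / 2 : ℕ) : ℤ) = 1 := by
    rw [← zpow_add₀ hQ0, neg_add_cancel, zpow_zero]
  refine ⟨hlow, hup, ?_, ?_⟩
  · refine (le_prod_ratio hQ (by omega)).trans ?_
    have := mul_le_mul_of_nonneg_right hlow hpos.le
    rwa [mul_right_comm, hcancel, one_mul] at this
  · have h1 := mul_le_mul_of_nonneg_right hup hpos.le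
    rw [add_mul, mul_right_comm, hcancel, one_mul] at h1
    refine h1.trans (add_le_add (prod_ratio_le_one hQ1 hrc) ?_)
    have hexp : r * (r + 1) / 2 = r * (r - 1) / 2 + r := by
      rcases r with _ | k
      · rfl
      · rw [Nat.add_sub_cancel, show (k + 1) * (k + 1 + 1) = (k + 1) * k + (k + 1) * 2 by ring,
          Nat.add_mul_div_right _ _ two_pos]
    have e : Q ^ ((r : ℤ) - c) * Q ^ ((r * (r - 1) / 2 : ℕ) : ℤ) =
        Q ^ (((r * (r + 1) / 2 : ℕ) : ℤ) - 1 - c) * Q := by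
      rw [← zpow_add₀ hQ0, ← zpow_add_one₀ hQ0, hexp]
      congr 1
      push_cast
      ring
    have hp : 0 < Q ^ (((r * (r + 1) / 2 : ℕ) : ℤ) - 1 - c) := by positivity
    rw [div_mul_eq_mul_div, e, div_le_iff₀ (by linarith)]
    nlinarith
end

section
/- Let ℓ be a prime power, F_ℓ a finite field with ℓ elements, n ≥ 1, c an even integer, and r ≥ 0 with 2r ≤ c ≤ n. Let V be a fixed r-dimensional subspace of F_ℓ^n. Among all n×n alternating matrices C over F_ℓ of rank exactly c, let A be their total number and A_V the number of those for which V is totally isotropic. Then (1 − 2ℓ^{2r−1−n}) · ℓ^{−r(r−1)/2} ≤ A_V/A ≤ (1 + 2ℓ^{r(r+1)/2 − 1 − c}) · ℓ^{−r(r−1)/2}. -/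
open Matrix BigOperators

/-- The number of `n×n` alternating matrices of rank `c` over `F`. -/
noncomputable def alternatingRankCount (F : Type) [Field F] (n c : ℕ) : ℕ :=
  Nat.card {C : Matrix (Fin n) (Fin n) F //
    Cᵀ = -C ∧ (∀ i, C i i = 0) ∧ C.rank = c}

/-- The number of `n×n` alternating matrices of rank `c` over `F` for which `V` is totally
isotropic. -/
noncomputable def alternatingRankIsotropicCount (F : Type) [Field F] {n : ℕ} (c : ℕ)
    (V : Submodule F (Fin n → F)) : ℕ :=
  Nat.card {C : Matrix (Fin n) (Fin n) F //
    (Cᵀ = -C ∧ (∀ i, C i i = 0) ∧ C.rank = c) ∧ TotallyIsotropic C V}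

section TupleCounting

variable {E : Type*} [Finite E]

theorem card_tuple_cons {r : ℕ} (Q : (Fin (r + 1) → E) → Prop) [Fintype (Fin r → E)] :
    Nat.card {w // Q w} = ∑ v : Fin r → E, Nat.card {x : E // Q (Fin.cons x v)} := by
  rw [← Nat.card_sigma]
  refine Nat.card_congr
    { toFun := fun w => ⟨Fin.tail w.1, w.1 0, by simpa using w.2⟩
      invFun := fun p => ⟨Fin.cons p.2.1 p.1, p.2.2⟩
      left_inv := fun w => by simp
      right_inv := fun p => rfl }

theorem card_subtype_eq_sum_ite {α : Type*} [Fintype α] (P : α → Prop) [DecidablePred P] :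
    (Nat.card {a // P a} : ℝ) = ∑ a, if P a then (1 : ℝ) else 0 := by
  rw [Nat.card_eq_fintype_card, Fintype.card_subtype]
  simp

theorem card_tuple_cons_le_add {r : ℕ} {Q : (Fin (r + 1) → E) → Prop}
    {P₁ P₂ : (Fin r → E) → Prop} {k₁ k₂ : ℝ} (hk₂ : 0 ≤ k₂)
    (hQ : ∀ v x, Q (Fin.cons x v) → P₁ v ∨ P₂ v)
    (h₁ : ∀ v, P₁ v → (Nat.card {x : E // Q (Fin.cons x v)} : ℝ) ≤ k₁)
    (h₂ : ∀ v, P₂ v → (Nat.card {x : E // Q (Fin.cons x v)} : ℝ) ≤ k₂) :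
    (Nat.card {w // Q w} : ℝ) ≤ Nat.card {v // P₁ v} * k₁ + Nat.card {v // P₂ v} * k₂ := by
  classical
  have := Fintype.ofFinite E
  rw [card_tuple_cons, card_subtype_eq_sum_ite, card_subtype_eq_sum_ite, Finset.sum_mul,
    Finset.sum_mul, ← Finset.sum_add_distrib]
  push_cast
  refine Finset.sum_le_sum fun v _ => ?_
  by_cases hv₁ : P₁ v
  · have := h₁ v hv₁
    by_cases hv₂ : P₂ v <;> simp only [hv₁, hv₂, if_true, if_false] <;> linarith
  by_cases hv₂ : P₂ v
  · have := h₂ v hv₂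
    simp only [hv₁, hv₂, if_true, if_false]
    linarith
  have : IsEmpty {x : E // Q (Fin.cons x v)} := ⟨fun x => (hQ v x.1 x.2).elim hv₁ hv₂⟩
  simp [hv₁, hv₂]

theorem card_tuple_cons_le {r : ℕ} {Q : (Fin (r + 1) → E) → Prop} {P : (Fin r → E) → Prop}
    {k : ℝ} (hQ : ∀ v x, Q (Fin.cons x v) → P v)
    (h : ∀ v, P v → (Nat.card {x : E // Q (Fin.cons x v)} : ℝ) ≤ k) :
    (Nat.card {w // Q w} : ℝ) ≤ Nat.card {v // P v} * k := by
  simpa using card_tuple_cons_le_add (P₂ := fun _ => False) le_rfl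
    (fun v x hx => Or.inl (hQ v x hx)) h (fun _ hv => hv.elim)

theorem le_card_tuple_cons {r : ℕ} {Q : (Fin (r + 1) → E) → Prop} {P : (Fin r → E) → Prop}
    {k : ℝ} (h : ∀ v, P v → k ≤ (Nat.card {x : E // Q (Fin.cons x v)} : ℝ)) :
    Nat.card {v // P v} * k ≤ (Nat.card {w // Q w} : ℝ) := by
  classical
  have := Fintype.ofFinite E
  rw [card_tuple_cons, card_subtype_eq_sum_ite, Finset.sum_mul]
  push_cast
  refine Finset.sum_le_sum fun v _ => ?_
  by_cases hv : P v
  · simpa [hv] using h v hv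
  · simp [hv]

end TupleCounting

theorem card_diff_submodule {F E : Type*} [Field F] [Fintype F] [AddCommGroup E] [Module F E]
    [Finite E] {W U : Submodule F E} (h : W ≤ U) :
    (Nat.card {x // x ∈ U ∧ x ∉ W} : ℝ) =
      (Fintype.card F : ℝ) ^ Module.finrank F U - (Fintype.card F : ℝ) ^ Module.finrank F W := by
  have hc : ∀ S : Submodule F E, (S : Set E).ncard = Fintype.card F ^ Module.finrank F S := by
    intro S
    have := Fintype.ofFinite S
    rw [← Module.card_eq_pow_finrank (K := F) (V := S), ← Nat.card_eq_fintype_card]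
    rfl
  have h1 : Nat.card {x // x ∈ U ∧ x ∉ W} = ((U : Set E) \ W).ncard := rfl
  have h2 := Set.ncard_sdiff_add_ncard_of_subset (s := (W : Set E)) (t := U) h
  rw [hc, hc] at h2
  rw [h1, eq_sub_iff_add_eq]
  exact_mod_cast h2

theorem zpow_neg_triangle_succ {q : ℝ} (hq : q ≠ 0) (r : ℕ) :
    q ^ (-(((r + 1) * (r + 1 - 1) / 2 : ℕ) : ℤ)) =
      (q ^ r)⁻¹ * q ^ (-((r * (r - 1) / 2 : ℕ) : ℤ)) := by
  rw [Nat.triangle_succ, ← zpow_natCast q r, ← _root_.zpow_neg, ← zpow_add₀ hq]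
  congr 1
  push_cast
  ring

section Alternating

variable {F : Type} [Field F] {n : ℕ}

theorem dotProduct_mulVec_swap_s6 {C : Matrix (Fin n) (Fin n) F} (hC : Cᵀ = -C)
    (x y : Fin n → F) : x ⬝ᵥ C *ᵥ y = -(y ⬝ᵥ C *ᵥ x) := by
  rw [dotProduct_comm, ← vecMul_transpose, hC, ← dotProduct_mulVec, neg_mulVec, dotProduct_neg]

theorem dotProduct_mulVec_self {m : Type*} [Fintype m] {C : Matrix m m F} (hC : Cᵀ = -C)
    (hd : ∀ i, C i i = 0) (x : m → F) : x ⬝ᵥ C *ᵥ x = 0 := by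
  have : x ⬝ᵥ C *ᵥ x = ∑ p : m × m, x p.1 * (C p.1 p.2 * x p.2) := by
    simp [dotProduct, mulVec, Finset.mul_sum, Fintype.sum_prod_type]
  rw [this]
  refine Finset.sum_involution (fun p _ => p.swap) ?_ ?_ ?_ ?_
  · rintro ⟨i, j⟩ -
    have : C j i = -C i j := congrFun (congrFun hC i) j
    simp only [Prod.swap, this]
    ring
  · rintro ⟨i, j⟩ - h0 h
    obtain rfl : j = i := congrArg Prod.fst h
    simp [hd] at h0
  · simp
  · simp

theorem totallyIsotropic_span_range_s6 {ι : Type*} {C : Matrix (Fin n) (Fin n) F}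
    (v : ι → Fin n → F) :
    TotallyIsotropic C (Submodule.span F (Set.range v)) ↔ ∀ i j, v i ⬝ᵥ C *ᵥ v j = 0 := by
  refine ⟨fun h i j => h _ (Submodule.subset_span ⟨i, rfl⟩) _ (Submodule.subset_span ⟨j, rfl⟩),
    fun h x hx y hy => ?_⟩
  refine Submodule.span_induction₂ (p := fun a b _ _ => a ⬝ᵥ C *ᵥ b = 0) ?_ ?_ ?_ ?_ ?_ ?_ ?_ hx hy
  · rintro _ _ ⟨i, rfl⟩ ⟨j, rfl⟩
    exact h i j
  · simp
  · simp
  · intro a b c _ _ _ h1 h2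
    rw [add_dotProduct, h1, h2, add_zero]
  · intro a b c _ _ _ h1 h2
    rw [mulVec_add, dotProduct_add, h1, h2, add_zero]
  · intro k a b _ _ h1
    rw [smul_dotProduct, h1, smul_zero]
  · intro k a b _ _ h1
    rw [mulVec_smul, dotProduct_smul, h1, smul_zero]

theorem exists_linearEquiv_map_eq {K E : Type*} [Field K] [AddCommGroup E] [Module K E]
    [FiniteDimensional K E] {V W : Submodule K E}
    (h : Module.finrank K V = Module.finrank K W) :
    ∃ e : E ≃ₗ[K] E, ∀ x ∈ V, e x ∈ W := by
  obtain ⟨V', hV⟩ := V.exists_isCompl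
  obtain ⟨W', hW⟩ := W.exists_isCompl
  have h1 := Submodule.finrank_add_eq_of_isCompl hV
  have h2 := Submodule.finrank_add_eq_of_isCompl hW
  let a : V ≃ₗ[K] W := LinearEquiv.ofFinrankEq _ _ h
  let b : V' ≃ₗ[K] W' := LinearEquiv.ofFinrankEq _ _ (by omega)
  refine ⟨(V.prodEquivOfIsCompl V' hV).symm ≪≫ₗ a.prodCongr b ≪≫ₗ W.prodEquivOfIsCompl W' hW,
    fun x hx => ?_⟩
  have : (V.prodEquivOfIsCompl V' hV).symm x = (⟨x, hx⟩, 0) :=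
    Submodule.prodEquivOfIsCompl_symm_apply_left V V' hV ⟨x, hx⟩
  simp [this]

theorem alternatingRankIsotropicCount_le [Finite F] (c : ℕ) {V W : Submodule F (Fin n → F)}
    (h : Module.finrank F V = Module.finrank F W) :
    alternatingRankIsotropicCount F c W ≤ alternatingRankIsotropicCount F c V := by
  obtain ⟨e, he⟩ := exists_linearEquiv_map_eq h
  set g := LinearMap.toMatrix' (e : (Fin n → F) →ₗ[F] Fin n → F) with hg
  set g' := LinearMap.toMatrix' (e.symm : (Fin n → F) →ₗ[F] Fin n → F) with hg'
  have hgg : g * g' = 1 := by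
    rw [hg, hg', ← LinearMap.toMatrix'_comp]
    simp
  have hgu : IsUnit g.det := Matrix.isUnit_det_of_right_inverse hgg
  have hge : ∀ x, g *ᵥ x = e x := fun x => by simp [hg, LinearMap.toMatrix'_mulVec]
  have hform : ∀ (C : Matrix (Fin n) (Fin n) F) x y,
      x ⬝ᵥ (gᵀ * C * g) *ᵥ y = e x ⬝ᵥ C *ᵥ e y := fun C x y => by
    rw [← mulVec_mulVec, ← mulVec_mulVec, hge, dotProduct_mulVec, vecMul_transpose, hge]
  refine Nat.card_le_card_of_injective
    (fun C => ⟨gᵀ * C.1 * g, ⟨?_, fun i => ?_, ?_⟩, fun x hx y hy => ?_⟩) ?_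
  · rw [transpose_mul, transpose_mul, C.2.1.1, transpose_transpose]
    simp [Matrix.mul_assoc]
  · have := dotProduct_mulVec_self C.2.1.1 C.2.1.2.1 (e (Pi.single i 1))
    rw [← hform] at this
    simpa using this
  · rw [rank_mul_eq_left_of_isUnit_det _ _ hgu,
      rank_mul_eq_right_of_isUnit_det _ _ (by rwa [det_transpose]), C.2.1.2.2]
  · rw [hform]
    exact C.2.2 _ (he x hx) _ (he y hy)
  · intro C D hCD
    have h1 : gᵀ * C.1 * g = gᵀ * D.1 * g := congrArg Subtype.val hCD
    have h2 : g'ᵀ * gᵀ = 1 := by rw [← transpose_mul, hgg, transpose_one]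
    have h3 : ∀ M : Matrix (Fin n) (Fin n) F, g'ᵀ * (gᵀ * M * g) * g' = M := fun M => by
      rw [Matrix.mul_assoc, Matrix.mul_assoc, hgg, Matrix.mul_one, ← Matrix.mul_assoc, h2,
        Matrix.one_mul]
    exact Subtype.ext (by rw [← h3 C.1, h1, h3])

theorem exists_alternating_rank {c : ℕ} (hc : Even c) (hcn : c ≤ n) :
    ∃ C : Matrix (Fin n) (Fin n) F, Cᵀ = -C ∧ (∀ i, C i i = 0) ∧ C.rank = c := by
  obtain ⟨s, rfl⟩ := hc
  let f : Fin s ⊕ Fin s → Fin n := fun x => Fin.castLE hcn (finSumFinEquiv x)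
  have hf : Function.Injective f := (Fin.castLE_injective hcn).comp finSumFinEquiv.injective
  let P : Matrix (Fin n) (Fin s ⊕ Fin s) F := (1 : Matrix (Fin n) (Fin n) F).submatrix id f
  have hP : Pᵀ * P = 1 := by
    ext i j
    simp [P, Matrix.mul_apply, Matrix.one_apply, hf.eq_iff]
  have hPP : ∀ M : Matrix (Fin s ⊕ Fin s) (Fin s ⊕ Fin s) F, Pᵀ * (P * M * Pᵀ) * P = M := by
    intro M
    rw [Matrix.mul_assoc, Matrix.mul_assoc, hP, Matrix.mul_one, ← Matrix.mul_assoc, hP,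
      Matrix.one_mul]
  refine ⟨P * J (Fin s) F * Pᵀ, ?_, fun i => ?_, le_antisymm ?_ ?_⟩
  · rw [transpose_mul, transpose_mul, J_transpose, transpose_transpose]
    simp [Matrix.mul_assoc]
  · have := dotProduct_mulVec_self (J_transpose (Fin s) F) (by rintro (k | k) <;> simp [J]) (P i)
    rwa [dotProduct_mulVec] at this
  · refine (rank_mul_le_left _ _).trans ((rank_mul_le_right _ _).trans ?_)
    simpa using rank_le_card_width (J (Fin s) F)
  · have hJ : (J (Fin s) F).rank = s + s := by
      rw [rank_of_isUnit _ ((isUnit_iff_isUnit_det _).2 (isUnit_det_J _ _))]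
      simp
    rw [← hJ]
    conv_lhs => rw [← hPP (J (Fin s) F)]
    exact (rank_mul_le_left _ _).trans (rank_mul_le_right _ _)

/-- The vectors orthogonal to every `v i` with respect to the form `C`. -/
def orthogonalSubmodule {r : ℕ} (C : Matrix (Fin n) (Fin n) F) (v : Fin r → Fin n → F) :
    Submodule F (Fin n → F) :=
  LinearMap.ker (of v * C).mulVecLin

theorem mem_orthogonalSubmodule {r : ℕ} {C : Matrix (Fin n) (Fin n) F}
    {v : Fin r → Fin n → F} {x : Fin n → F} :
    x ∈ orthogonalSubmodule C v ↔ ∀ i, v i ⬝ᵥ C *ᵥ x = 0 := by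
  rw [orthogonalSubmodule, LinearMap.mem_ker, mulVecLin_apply, ← mulVec_mulVec, funext_iff]
  rfl

theorem rank_add_finrank_orthogonalSubmodule {r : ℕ} (C : Matrix (Fin n) (Fin n) F)
    (v : Fin r → Fin n → F) :
    (of v * C).rank + Module.finrank F (orthogonalSubmodule C v) = n := by
  have := LinearMap.finrank_range_add_finrank_ker (of v * C).mulVecLin
  rwa [Module.finrank_fin_fun] at this

/-- Linearly independent tuples of vectors spanning a totally isotropic subspace for `C`. -/
def IsIsotropicTuple {r : ℕ} (C : Matrix (Fin n) (Fin n) F) (v : Fin r → Fin n → F) : Prop :=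
  LinearIndependent F v ∧ ∀ i j, v i ⬝ᵥ C *ᵥ v j = 0

theorem isIsotropicTuple_cons {r : ℕ} {C : Matrix (Fin n) (Fin n) F} (hC : Cᵀ = -C)
    (hd : ∀ i, C i i = 0) {v : Fin r → Fin n → F} {x : Fin n → F} :
    IsIsotropicTuple C (Fin.cons x v : Fin (r + 1) → Fin n → F) ↔
      IsIsotropicTuple C v ∧
        x ∈ orthogonalSubmodule C v ∧ x ∉ Submodule.span F (Set.range v) := by
  rw [IsIsotropicTuple, IsIsotropicTuple, linearIndependent_finCons, mem_orthogonalSubmodule]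
  constructor
  · rintro ⟨⟨h1, h2⟩, h3⟩
    exact ⟨⟨h1, fun i j => by simpa using h3 i.succ j.succ⟩,
      fun i => by simpa using h3 i.succ 0, h2⟩
  · rintro ⟨⟨h1, h2⟩, h3, h4⟩
    refine ⟨⟨h1, h4⟩, fun i j => ?_⟩
    refine Fin.cases ?_ (fun i => ?_) i <;> refine Fin.cases ?_ (fun j => ?_) j
    · exact dotProduct_mulVec_self hC hd x
    · simp [dotProduct_mulVec_swap_s6 hC x, h3]
    · simpa using h3 i
    · simpa using h2 i j

theorem IsIsotropicTuple.span_le {r : ℕ} {C : Matrix (Fin n) (Fin n) F} {v : Fin r → Fin n → F}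
    (h : IsIsotropicTuple C v) :
    Submodule.span F (Set.range v) ≤ orthogonalSubmodule C v := by
  rw [Submodule.span_le]
  rintro _ ⟨j, rfl⟩
  exact mem_orthogonalSubmodule.2 fun i => h.2 i j

variable [Fintype F]

theorem card_linearIndependent_tuple_succ (r : ℕ) :
    (Nat.card {v : Fin (r + 1) → Fin n → F // LinearIndependent F v} : ℝ) =
      Nat.card {v : Fin r → Fin n → F // LinearIndependent F v} *
        ((Fintype.card F : ℝ) ^ n - (Fintype.card F : ℝ) ^ r) := by
  have key : ∀ v : Fin r → Fin n → F, LinearIndependent F v →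
      (Nat.card {x : Fin n → F //
        LinearIndependent F (Fin.cons x v : Fin (r + 1) → Fin n → F)} : ℝ) =
        (Fintype.card F : ℝ) ^ n - (Fintype.card F : ℝ) ^ r := by
    intro v hv
    have h1 := card_diff_submodule (F := F) (le_top (a := Submodule.span F (Set.range v)))
    rw [finrank_span_eq_card hv, finrank_top, Module.finrank_fin_fun, Fintype.card_fin] at h1
    rw [← h1]
    simp [linearIndependent_finCons, hv]
  refine le_antisymm (card_tuple_cons_le (fun v x h => ?_) fun v hv => (key v hv).le)
    (le_card_tuple_cons fun v hv => (key v hv).ge)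
  exact (linearIndependent_finCons.1 h).1

theorem card_isIsotropicTuple_succ_ge {C : Matrix (Fin n) (Fin n) F} (hC : Cᵀ = -C)
    (hd : ∀ i, C i i = 0) {r : ℕ} (hr : r ≤ n) :
    Nat.card {v : Fin r → Fin n → F // IsIsotropicTuple C v} *
        ((Fintype.card F : ℝ) ^ (n - r) - (Fintype.card F : ℝ) ^ r) ≤
      Nat.card {v : Fin (r + 1) → Fin n → F // IsIsotropicTuple C v} := by
  refine le_card_tuple_cons fun v hv => ?_
  have h1 := card_diff_submodule hv.span_le
  have h2 := rank_add_finrank_orthogonalSubmodule C v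
  have h3 : (of v * C).rank ≤ r := rank_le_height _
  simp only [isIsotropicTuple_cons hC hd, hv, true_and]
  rw [h1, finrank_span_eq_card hv.1, Fintype.card_fin]
  gcongr
  · exact_mod_cast Fintype.card_pos (α := F)
  · omega

theorem card_isIsotropicTuple_good_succ_le {C : Matrix (Fin n) (Fin n) F} (hC : Cᵀ = -C)
    (hd : ∀ i, C i i = 0) (r : ℕ) :
    (Nat.card {v : Fin (r + 1) → Fin n → F //
        IsIsotropicTuple C v ∧ LinearIndependent F fun i => v i ᵥ* C} : ℝ) ≤
      Nat.card {v : Fin r → Fin n → F //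
        IsIsotropicTuple C v ∧ LinearIndependent F fun i => v i ᵥ* C} *
        ((Fintype.card F : ℝ) ^ (n - r) - (Fintype.card F : ℝ) ^ r) := by
  refine card_tuple_cons_le (fun v x h => ?_) fun v hv => ?_
  · exact ⟨((isIsotropicTuple_cons hC hd).1 h.1).1, by
      simpa [Function.comp_def] using h.2.comp Fin.succ (Fin.succ_injective _)⟩
  · have h1 := card_diff_submodule hv.1.span_le
    have h2 := rank_add_finrank_orthogonalSubmodule C v
    have h3 : (of v * C).rank = r := by
      have : LinearIndependent F (of v * C).row := hv.2
      simpa using this.rank_matrix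
    have h4 : Module.finrank F (orthogonalSubmodule C v) = n - r := by omega
    rw [h4, finrank_span_eq_card hv.1.1, Fintype.card_fin] at h1
    rw [← h1]
    refine Nat.cast_le.2 (Nat.card_le_card_of_injective
      (fun x => ⟨x.1, ((isIsotropicTuple_cons hC hd).1 x.2.1).2⟩) fun x y h => ?_)
    simpa [Subtype.ext_iff] using h

theorem card_linearIndependent_bad_succ_le {C : Matrix (Fin n) (Fin n) F} (r : ℕ) :
    (Nat.card {v : Fin (r + 1) → Fin n → F //
        LinearIndependent F v ∧ ¬ LinearIndependent F fun i => v i ᵥ* C} : ℝ) ≤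
      Nat.card {v : Fin r → Fin n → F //
        LinearIndependent F v ∧ ¬ LinearIndependent F fun i => v i ᵥ* C} *
        ((Fintype.card F : ℝ) ^ n - (Fintype.card F : ℝ) ^ r) +
      Nat.card {v : Fin r → Fin n → F // LinearIndependent F v} *
        ((Fintype.card F : ℝ) ^ (n - C.rank + r) - (Fintype.card F : ℝ) ^ r) := by
  have hF : (1 : ℝ) ≤ Fintype.card F := by exact_mod_cast Fintype.card_pos (α := F)
  have hcn : C.rank ≤ n := rank_le_width C
  have hcons : ∀ (v : Fin r → Fin n → F) (x : Fin n → F),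
      (fun i : Fin (r + 1) => (Fin.cons x v : Fin (r + 1) → Fin n → F) i ᵥ* C) =
        Fin.cons (x ᵥ* C) (fun i => v i ᵥ* C) := by
    intro v x
    ext i : 1
    refine Fin.cases ?_ (fun i => ?_) i <;> simp
  refine card_tuple_cons_le_add
    (P₁ := fun v => LinearIndependent F v ∧ ¬ LinearIndependent F fun i => v i ᵥ* C)
    (P₂ := fun v => LinearIndependent F v ∧ LinearIndependent F fun i => v i ᵥ* C)
    (k₁ := (Fintype.card F : ℝ) ^ n - (Fintype.card F : ℝ) ^ r)
    (k₂ := (Fintype.card F : ℝ) ^ (n - C.rank + r) - (Fintype.card F : ℝ) ^ r)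
    (sub_nonneg.2 (pow_le_pow_right₀ hF (by omega))) (fun v x h => ?_) (fun v hv => ?_)
    (fun v hv => ?_) |>.trans ?_
  · have := (linearIndependent_finCons.1 h.1).1
    tauto
  · have h1 := card_diff_submodule (F := F) (le_top (a := Submodule.span F (Set.range v)))
    rw [finrank_span_eq_card hv.1, finrank_top, Module.finrank_fin_fun, Fintype.card_fin] at h1
    rw [← h1]
    refine Nat.cast_le.2 (Nat.card_le_card_of_injective
      (fun x => ⟨x.1, trivial, (linearIndependent_finCons.1 x.2.1).2⟩) fun x y h => ?_)
    simpa [Subtype.ext_iff] using h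
  · let W := Submodule.span F (Set.range v)
    let K := LinearMap.ker C.vecMulLinear
    have h1 := card_diff_submodule (le_sup_left : W ≤ W ⊔ K)
    have hW : Module.finrank F W = r := by
      simpa using finrank_span_eq_card hv.1
    have hK : C.rank + Module.finrank F K = n := by
      have := LinearMap.finrank_range_add_finrank_ker C.vecMulLinear
      rwa [Module.finrank_fin_fun, range_vecMulLinear, ← rank_eq_finrank_span_row] at this
    have hWK := Submodule.finrank_add_le_finrank_add_finrank W K
    have hmem : ∀ x, LinearIndependent F (Fin.cons x v : Fin (r + 1) → Fin n → F) ∧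
        ¬ LinearIndependent F
          (fun i => (Fin.cons x v : Fin (r + 1) → Fin n → F) i ᵥ* C) → x ∈ W ⊔ K ∧ x ∉ W := by
      rintro x ⟨hx1, hx2⟩
      refine ⟨?_, (linearIndependent_finCons.1 hx1).2⟩
      rw [hcons, linearIndependent_finCons] at hx2
      have hx3 : x ᵥ* C ∈ Submodule.span F (Set.range fun i => v i ᵥ* C) := by
        by_contra h
        exact hx2 ⟨hv.2, h⟩
      rw [← Submodule.comap_map_eq, Submodule.mem_comap, Submodule.map_span, ← Set.range_comp]
      exact hx3
    calc _ ≤ (Nat.card {x // x ∈ W ⊔ K ∧ x ∉ W} : ℝ) := by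
          refine Nat.cast_le.2 (Nat.card_le_card_of_injective
            (fun x => ⟨x.1, hmem x.1 x.2⟩) fun x y h => ?_)
          simpa [Subtype.ext_iff] using h
      _ ≤ _ := by
          rw [h1, hW]
          gcongr
          omega
  · gcongr
    · exact sub_nonneg.2 (pow_le_pow_right₀ hF (by omega))
    · refine Nat.card_le_card_of_injective (fun x => ⟨x.1, x.2.1⟩) fun x y h => ?_
      simpa [Subtype.ext_iff] using h

theorem card_isIsotropicTuple_ge {C : Matrix (Fin n) (Fin n) F} (hC : Cᵀ = -C)
    (hd : ∀ i, C i i = 0) (r : ℕ) (hr : 2 * r ≤ n) :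
    (Nat.card {v : Fin r → Fin n → F // LinearIndependent F v} : ℝ) *
        ((1 - (Fintype.card F : ℝ) ^ (2 * (r : ℤ) - 1 - n)) *
          (Fintype.card F : ℝ) ^ (-((r * (r - 1) / 2 : ℕ) : ℤ))) ≤
      Nat.card {v : Fin r → Fin n → F // IsIsotropicTuple C v} := by
  have hq : (2 : ℝ) ≤ Fintype.card F := by exact_mod_cast Fintype.one_lt_card (α := F)
  have hq0 : (Fintype.card F : ℝ) ≠ 0 := by positivity
  induction r with
  | zero =>
    have : ∀ v : Fin 0 → Fin n → F, IsIsotropicTuple C v := fun v =>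
      ⟨linearIndependent_empty_type, fun i => i.elim0⟩
    simp [this]
    positivity
  | succ r ih =>
    refine le_trans ?_ (card_isIsotropicTuple_succ_ge hC hd (by omega))
    rw [card_linearIndependent_tuple_succ]
    set q := (Fintype.card F : ℝ)
    set T := (Nat.card {v : Fin r → Fin n → F // LinearIndependent F v} : ℝ)
    have hT : 0 ≤ T := Nat.cast_nonneg _
    have e1 : q ^ (2 * ((r + 1 : ℕ) : ℤ) - 1 - n) = q ^ 2 * q ^ (2 * (r : ℤ) - 1 - n) := by
      rw [← zpow_natCast q 2, ← zpow_add₀ hq0]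
      congr 1
      push_cast
      ring
    have e3 : q ^ (n - r) = q ^ n * (q ^ r)⁻¹ := by
      rw [pow_sub₀ q hq0 (by omega)]
    have e4 : q ^ r * q ^ r = q ^ n * (q * q ^ (2 * (r : ℤ) - 1 - n)) := by
      rw [← zpow_natCast q n, ← zpow_natCast q r, ← zpow_one_add₀ hq0, ← zpow_add₀ hq0,
        ← zpow_add₀ hq0]
      congr 1
      ring
    have hge : q ^ r ≤ q ^ (n - r) := pow_le_pow_right₀ (by linarith) (by omega)
    refine le_trans ?_ (mul_le_mul_of_nonneg_right (ih (by omega)) (sub_nonneg.2 hge))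
    rw [e1, zpow_neg_triangle_succ hq0, e3]
    have hx0 : 0 ≤ q ^ (2 * (r : ℤ) - 1 - n) := by positivity
    have hx1 : q ^ 2 * q ^ (2 * (r : ℤ) - 1 - n) ≤ 1 := by
      rw [← e1]
      exact zpow_le_one_of_nonpos₀ (by linarith) (by push_cast; omega)
    set x := q ^ (2 * (r : ℤ) - 1 - n)
    set K := q ^ (-((r * (r - 1) / 2 : ℕ) : ℤ))
    have hK : 0 ≤ K := by positivity
    have hA : 0 < q ^ r := by positivity
    have hA1 : 1 ≤ q ^ r := one_le_pow₀ (by linarith)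
    have hN : 0 < q ^ n := by positivity
    set A := q ^ r
    set N := q ^ n
    have hkey : (N - A) * (1 - q ^ 2 * x) ≤ (1 - x) * (N - A * A) := by
      rw [e4]
      calc (N - A) * (1 - q ^ 2 * x) ≤ N * (1 - q ^ 2 * x) := by
            gcongr
            linarith
        _ ≤ N * ((1 - x) * (1 - q * x)) := by
            gcongr
            have : (1 + q) * x ≤ q ^ 2 * x := by
              gcongr
              nlinarith
            nlinarith [mul_nonneg hx0 (mul_nonneg (by linarith : (0 : ℝ) ≤ q) hx0)]
        _ = _ := by ring
    calc T * (N - A) * ((1 - q ^ 2 * x) * (A⁻¹ * K))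
        = (T * K * A⁻¹) * ((N - A) * (1 - q ^ 2 * x)) := by ring
      _ ≤ (T * K * A⁻¹) * ((1 - x) * (N - A * A)) := by gcongr
      _ = _ := by field_simp

theorem card_isIsotropicTuple_good_le {C : Matrix (Fin n) (Fin n) F} (hC : Cᵀ = -C)
    (hd : ∀ i, C i i = 0) (r : ℕ) (hr : 2 * r ≤ n) :
    (Nat.card {v : Fin r → Fin n → F //
        IsIsotropicTuple C v ∧ LinearIndependent F fun i => v i ᵥ* C} : ℝ) ≤
      Nat.card {v : Fin r → Fin n → F // LinearIndependent F v} *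
        (Fintype.card F : ℝ) ^ (-((r * (r - 1) / 2 : ℕ) : ℤ)) := by
  have hq : (2 : ℝ) ≤ Fintype.card F := by exact_mod_cast Fintype.one_lt_card (α := F)
  have hq0 : (Fintype.card F : ℝ) ≠ 0 := by positivity
  induction r with
  | zero =>
    have : ∀ v : Fin 0 → Fin n → F, IsIsotropicTuple C v := fun v =>
      ⟨linearIndependent_empty_type, fun i => i.elim0⟩
    simp [this]
  | succ r ih =>
    refine (card_isIsotropicTuple_good_succ_le hC hd r).trans ?_
    rw [card_linearIndependent_tuple_succ]
    set q := (Fintype.card F : ℝ)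
    set T := (Nat.card {v : Fin r → Fin n → F // LinearIndependent F v} : ℝ)
    have hT : 0 ≤ T := Nat.cast_nonneg _
    have e3 : q ^ (n - r) = q ^ n * (q ^ r)⁻¹ := by
      rw [pow_sub₀ q hq0 (by omega)]
    have hge : q ^ r ≤ q ^ (n - r) := pow_le_pow_right₀ (by linarith) (by omega)
    refine (mul_le_mul_of_nonneg_right (ih (by omega)) (sub_nonneg.2 hge)).trans ?_
    rw [zpow_neg_triangle_succ hq0, e3]
    set K := q ^ (-((r * (r - 1) / 2 : ℕ) : ℤ))
    have hA1 : 1 ≤ q ^ r := one_le_pow₀ (by linarith)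
    set A := q ^ r
    have hAi : A⁻¹ ≤ 1 := inv_le_one_of_one_le₀ hA1
    have hA : A * A⁻¹ = 1 := mul_inv_cancel₀ (by positivity)
    calc T * K * (q ^ n * A⁻¹ - A) ≤ T * K * (q ^ n * A⁻¹ - A * A⁻¹) := by
          gcongr
          linarith
      _ = _ := by ring

theorem card_linearIndependent_bad_le (C : Matrix (Fin n) (Fin n) F) (r : ℕ)
    (hr : 2 * r ≤ C.rank) :
    (Nat.card {v : Fin r → Fin n → F //
        LinearIndependent F v ∧ ¬ LinearIndependent F fun i => v i ᵥ* C} : ℝ) ≤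
      Nat.card {v : Fin r → Fin n → F // LinearIndependent F v} *
        (2 * (Fintype.card F : ℝ) ^ ((r : ℤ) - 1 - C.rank)) := by
  have hq : (2 : ℝ) ≤ Fintype.card F := by exact_mod_cast Fintype.one_lt_card (α := F)
  have hq0 : (Fintype.card F : ℝ) ≠ 0 := by positivity
  have hcn : C.rank ≤ n := rank_le_width C
  induction r with
  | zero =>
    simp
    positivity
  | succ r ih =>
    refine (card_linearIndependent_bad_succ_le r).trans ?_
    rw [card_linearIndependent_tuple_succ]
    set q := (Fintype.card F : ℝ)
    set T := (Nat.card {v : Fin r → Fin n → F // LinearIndependent F v} : ℝ)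
    have hT : 0 ≤ T := Nat.cast_nonneg _
    have hge : q ^ r ≤ q ^ n := pow_le_pow_right₀ (by linarith) (by omega)
    refine (add_le_add_left (mul_le_mul_of_nonneg_right (ih (by omega)) (sub_nonneg.2 hge)) _).trans
      ?_
    have e1 : q ^ (((r + 1 : ℕ) : ℤ) - 1 - C.rank) = q * q ^ ((r : ℤ) - 1 - C.rank) := by
      rw [← zpow_one_add₀ hq0]
      congr 1
      push_cast
      ring
    have e2 : q ^ (n - C.rank + r) = q ^ n * (q * q ^ ((r : ℤ) - 1 - C.rank)) := by
      rw [← zpow_one_add₀ hq0, ← zpow_natCast, ← zpow_natCast, ← zpow_add₀ hq0]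
      congr 1
      push_cast [hcn]
      ring
    have hx1 : q * q ^ ((r : ℤ) - 1 - C.rank) ≤ 1 := by
      rw [← e1]
      exact zpow_le_one_of_nonpos₀ (by linarith) (by push_cast; omega)
    rw [e1, e2]
    have hx0 : 0 ≤ q ^ ((r : ℤ) - 1 - C.rank) := by positivity
    set x := q ^ ((r : ℤ) - 1 - C.rank)
    have hA : 0 < q ^ r := by positivity
    have h1 : q ^ n * (q * x) - q ^ r ≤ (q ^ n - q ^ r) * (q * x) := by nlinarith
    have h2 : (q ^ n - q ^ r) * (2 * x) ≤ (q ^ n - q ^ r) * (q * x) := by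
      gcongr
    calc _ ≤ T * ((q ^ n - q ^ r) * (q * x)) + T * ((q ^ n - q ^ r) * (q * x)) := by
          rw [mul_assoc T (2 * x), mul_comm (2 * x)]
          gcongr
      _ = _ := by ring

theorem card_linearIndependent_mul_alternatingRankIsotropicCount (c : ℕ)
    (V : Submodule F (Fin n → F)) :
    Nat.card {v : Fin (Module.finrank F V) → Fin n → F // LinearIndependent F v} *
        alternatingRankIsotropicCount F c V =
      ∑ᶠ C : {C : Matrix (Fin n) (Fin n) F // Cᵀ = -C ∧ (∀ i, C i i = 0) ∧ C.rank = c},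
        Nat.card {v : Fin (Module.finrank F V) → Fin n → F // IsIsotropicTuple C.1 v} := by
  classical
  have := Fintype.ofFinite
    {v : Fin (Module.finrank F V) → Fin n → F // LinearIndependent F v}
  have := Fintype.ofFinite
    {C : Matrix (Fin n) (Fin n) F // Cᵀ = -C ∧ (∀ i, C i i = 0) ∧ C.rank = c}
  have h1 : ∀ v : {v : Fin (Module.finrank F V) → Fin n → F // LinearIndependent F v},
      alternatingRankIsotropicCount F c V =
        alternatingRankIsotropicCount F c (Submodule.span F (Set.range v.1)) := fun v => by
    have : Module.finrank F (Submodule.span F (Set.range v.1)) = Module.finrank F V := by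
      simpa using finrank_span_eq_card v.2
    exact le_antisymm (alternatingRankIsotropicCount_le c this)
      (alternatingRankIsotropicCount_le c this.symm)
  rw [finsum_eq_sum_of_fintype, ← Nat.card_sigma, ← smul_eq_mul, Nat.card_eq_fintype_card,
    ← Finset.card_univ, ← Finset.sum_const, Finset.sum_congr rfl fun v _ => h1 v]
  unfold alternatingRankIsotropicCount
  rw [← Nat.card_sigma]
  exact Nat.card_congr
    { toFun := fun p => ⟨⟨p.2.1, p.2.2.1⟩, p.1.1, p.1.2,
        (totallyIsotropic_span_range_s6 _).1 p.2.2.2⟩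
      invFun := fun p => ⟨⟨p.2.1, p.2.2.1⟩, p.1.1, p.1.2,
        (totallyIsotropic_span_range_s6 _).2 p.2.2.2⟩
      left_inv := fun _ => rfl
      right_inv := fun _ => rfl }

theorem card_isIsotropicTuple_le {C : Matrix (Fin n) (Fin n) F} (hC : Cᵀ = -C)
    (hd : ∀ i, C i i = 0) (r : ℕ) (hr : 2 * r ≤ C.rank) :
    (Nat.card {v : Fin r → Fin n → F // IsIsotropicTuple C v} : ℝ) ≤
      Nat.card {v : Fin r → Fin n → F // LinearIndependent F v} *
        ((1 + 2 * (Fintype.card F : ℝ) ^ (((r * (r + 1) / 2 : ℕ) : ℤ) - 1 - C.rank)) *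
          (Fintype.card F : ℝ) ^ (-((r * (r - 1) / 2 : ℕ) : ℤ))) := by
  have hq0 : (Fintype.card F : ℝ) ≠ 0 := by exact_mod_cast Fintype.card_ne_zero
  have hsplit : Nat.card {v : Fin r → Fin n → F // IsIsotropicTuple C v} ≤
      Nat.card {v : Fin r → Fin n → F //
        IsIsotropicTuple C v ∧ LinearIndependent F fun i => v i ᵥ* C} +
      Nat.card {v : Fin r → Fin n → F //
        LinearIndependent F v ∧ ¬ LinearIndependent F fun i => v i ᵥ* C} := by
    refine le_trans (Set.ncard_le_ncard (t := {v : Fin r → Fin n → F |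
        IsIsotropicTuple C v ∧ LinearIndependent F fun i => v i ᵥ* C} ∪
      {v | LinearIndependent F v ∧ ¬ LinearIndependent F fun i => v i ᵥ* C}) fun v hv => ?_)
      (Set.ncard_union_le _ _)
    have h1 : IsIsotropicTuple C v := hv
    by_cases h : LinearIndependent F fun i => v i ᵥ* C
    · exact Or.inl ⟨h1, h⟩
    · exact Or.inr ⟨h1.1, h⟩
  refine (Nat.cast_le (α := ℝ).2 hsplit).trans ?_
  rw [Nat.cast_add]
  refine (add_le_add (card_isIsotropicTuple_good_le hC hd r (hr.trans (rank_le_width C)))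
    (card_linearIndependent_bad_le C r hr)).trans_eq ?_
  have h2 : r * (r + 1) / 2 = r * (r - 1) / 2 + r := by
    rw [← Nat.triangle_succ, mul_comm, Nat.add_sub_cancel]
  rw [add_mul, one_mul, mul_assoc 2, ← zpow_add₀ hq0, h2, mul_add]
  generalize r * (r - 1) / 2 = k
  congr 4
  push_cast
  ring

end Alternating

/-- **Probability that a fixed subspace is isotropic for a random alternating form of rank
`c`.**  For `c` even, `2r ≤ c ≤ n`, and `V` a fixed `r`-dimensional subspace of `F_ℓ^n`,
the proportion `A_V / A` of rank-`c` alternating `n×n` matrices for which `V` is totally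
isotropic satisfies
`(1 - 2ℓ^{2r-1-n})·ℓ^{-r(r-1)/2} ≤ A_V/A ≤ (1 + 2ℓ^{r(r+1)/2-1-c})·ℓ^{-r(r-1)/2}`. -/
theorem isotropic_probability_random_form (F : Type) [Field F] [Fintype F]
    (ℓ n c r : ℕ) (hℓ : Fintype.card F = ℓ) (hn : 1 ≤ n)
    (hceven : Even c) (hrc : 2 * r ≤ c) (hcn : c ≤ n)
    (V : Submodule F (Fin n → F)) (hV : Module.finrank F V = r) :
    ((1 - 2 * (ℓ : ℝ) ^ (2 * (r : ℤ) - 1 - n)) *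
        (ℓ : ℝ) ^ (-((r * (r - 1) / 2 : ℕ) : ℤ))
      ≤ (alternatingRankIsotropicCount F c V : ℝ) / (alternatingRankCount F n c : ℝ)) ∧
    ((alternatingRankIsotropicCount F c V : ℝ) / (alternatingRankCount F n c : ℝ)
      ≤ (1 + 2 * (ℓ : ℝ) ^ (((r * (r + 1) / 2 : ℕ) : ℤ) - 1 - c)) *
        (ℓ : ℝ) ^ (-((r * (r - 1) / 2 : ℕ) : ℤ))) := by
  subst hℓ hV
  set A := {C : Matrix (Fin n) (Fin n) F // Cᵀ = -C ∧ (∀ i, C i i = 0) ∧ C.rank = c}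
  set r := Module.finrank F V
  have hA : alternatingRankCount F n c = Nat.card A := rfl
  have hA0 : (0 : ℝ) < Nat.card A := by
    obtain ⟨C, hC⟩ := exists_alternating_rank (F := F) hceven hcn
    have : Nonempty A := ⟨⟨C, hC⟩⟩
    exact_mod_cast Nat.card_pos
  have := Fintype.ofFinite A
  have hT0 : (0 : ℝ) < Nat.card {v : Fin r → Fin n → F // LinearIndependent F v} := by
    have : Nonempty {v : Fin r → Fin n → F // LinearIndependent F v} :=
      ⟨⟨fun i => (Module.finBasis F V i : Fin n → F),
        (Module.finBasis F V).linearIndependent.map' V.subtype V.ker_subtype⟩⟩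
    exact_mod_cast Nat.card_pos
  have hcount := card_linearIndependent_mul_alternatingRankIsotropicCount c V
  rw [finsum_eq_sum_of_fintype] at hcount
  have hcount' := congrArg (Nat.cast : ℕ → ℝ) hcount
  push_cast at hcount'
  have hconst : ∀ x y : ℝ, x * (y * Nat.card A) = ∑ _C : A, x * y := fun x y => by
    simp only [Finset.sum_const, Finset.card_univ, nsmul_eq_mul, Nat.card_eq_fintype_card]
    ring
  rw [hA, le_div_iff₀ hA0, div_le_iff₀ hA0]
  constructor
  · refine le_of_mul_le_mul_left ?_ hT0
    rw [hcount', hconst]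
    refine Finset.sum_le_sum fun C _ =>
      le_trans ?_ (card_isIsotropicTuple_ge C.2.1 C.2.2.1 r (hrc.trans hcn))
    have : 0 ≤ (Fintype.card F : ℝ) ^ (2 * (r : ℤ) - 1 - n) := by positivity
    gcongr
    linarith
  · refine le_of_mul_le_mul_left ?_ hT0
    rw [hcount', hconst]
    refine Finset.sum_le_sum fun C _ => ?_
    have := card_isIsotropicTuple_le C.2.1 C.2.2.1 r (hrc.trans_eq C.2.2.2.symm)
    rwa [C.2.2.2] at this
end

section
/- Let ℓ ≥ 2 be a real number (in particular any prime power) and let r ≥ 0 and n be integers with n ≥ 2r. Then |∏_{i=0}^{r−1} (1 − ℓ^{2i−n})/(1 − ℓ^{i−n}) − 1| ≤ 2ℓ^{2r−1−n}. -/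
open BigOperators

/-- Each factor lies between `1 - ℓ^{2i-n}` and `1`, and is nonnegative. -/
theorem factor_bounds {ℓ : ℝ} (hℓ : 1 < ℓ) {i n : ℕ} (h : 2 * i < n) :
    0 ≤ (1 - ℓ ^ (2 * (i : ℤ) - n)) / (1 - ℓ ^ ((i : ℤ) - n)) ∧
      1 - ℓ ^ (2 * (i : ℤ) - n) ≤ (1 - ℓ ^ (2 * (i : ℤ) - n)) / (1 - ℓ ^ ((i : ℤ) - n)) ∧
      (1 - ℓ ^ (2 * (i : ℤ) - n)) / (1 - ℓ ^ ((i : ℤ) - n)) ≤ 1 := by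
  have ha : ℓ ^ (2 * (i : ℤ) - n) < 1 := zpow_lt_one_of_neg₀ hℓ (by omega)
  have hba : ℓ ^ ((i : ℤ) - n) ≤ ℓ ^ (2 * (i : ℤ) - n) :=
    zpow_le_zpow_right₀ hℓ.le (by omega)
  have hb : 0 < ℓ ^ ((i : ℤ) - n) := zpow_pos (by linarith) _
  have hd : 0 < 1 - ℓ ^ ((i : ℤ) - n) := by linarith
  refine ⟨div_nonneg (by linarith) hd.le, ?_, (div_le_one hd).2 (by linarith)⟩
  exact le_div_self (by linarith) hd (by linarith)

/-- The product lies in `[0, 1]` and is at least `1 - 2 ℓ^{2r-1-n}`. -/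
theorem product_bounds {ℓ : ℝ} (hℓ : 2 ≤ ℓ) {r n : ℕ} (h : 2 * r ≤ n) :
    0 ≤ ∏ i ∈ Finset.range r, (1 - ℓ ^ (2 * (i : ℤ) - n)) / (1 - ℓ ^ ((i : ℤ) - n)) ∧
      ∏ i ∈ Finset.range r, (1 - ℓ ^ (2 * (i : ℤ) - n)) / (1 - ℓ ^ ((i : ℤ) - n)) ≤ 1 ∧
      1 - 2 * ℓ ^ (2 * (r : ℤ) - 1 - n) ≤
        ∏ i ∈ Finset.range r, (1 - ℓ ^ (2 * (i : ℤ) - n)) / (1 - ℓ ^ ((i : ℤ) - n)) := by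
  have hℓ0 : 0 < ℓ := by linarith
  induction r with
  | zero =>
    have := zpow_pos hℓ0 (2 * ((0 : ℕ) : ℤ) - 1 - n)
    simp only [Finset.range_zero, Finset.prod_empty]
    refine ⟨zero_le_one, le_rfl, by linarith⟩
  | succ r ih =>
    obtain ⟨hP0, hP1, hP⟩ := ih (by omega)
    obtain ⟨hf0, hfa, hf1⟩ := factor_bounds (by linarith : 1 < ℓ) (by omega : 2 * r < n)
    rw [Finset.prod_range_succ]
    refine ⟨mul_nonneg hP0 hf0, mul_le_one₀ hP1 hf0 hf1, ?_⟩
    have hz := zpow_pos hℓ0 (2 * (r : ℤ) - 1 - n)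
    have ea : ℓ ^ (2 * (r : ℤ) - n) = ℓ ^ (2 * (r : ℤ) - 1 - n) * ℓ := by
      rw [← zpow_add_one₀ hℓ0.ne']
      congr 1
      ring
    have es : ℓ ^ (2 * ((r + 1 : ℕ) : ℤ) - 1 - n) = ℓ ^ (2 * (r : ℤ) - 1 - n) * ℓ * ℓ := by
      rw [← zpow_add_one₀ hℓ0.ne', ← zpow_add_one₀ hℓ0.ne']
      congr 1
      push_cast
      ring
    rw [es]
    generalize (1 - ℓ ^ (2 * (r : ℤ) - n)) / (1 - ℓ ^ ((r : ℤ) - n)) = f at *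
    rw [ea] at hfa
    have hmul := mul_nonneg (sub_nonneg.2 hP1) (sub_nonneg.2 hf1)
    have hq : 0 ≤ ℓ ^ (2 * (r : ℤ) - 1 - n) * (2 * ℓ * ℓ - ℓ - 2) :=
      mul_nonneg hz.le (by nlinarith)
    linarith

/-- **Product error estimate.**  For a real number `ℓ ≥ 2` and integers `n ≥ 2r ≥ 0`,
`|∏_{i=0}^{r-1} (1 - ℓ^{2i-n})/(1 - ℓ^{i-n}) - 1| ≤ 2 ℓ^{2r-1-n}`. -/
theorem product_error_estimate (ℓ : ℝ) (hℓ : 2 ≤ ℓ) (r n : ℕ) (h : 2 * r ≤ n) :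
    |(∏ i ∈ Finset.range r,
        (1 - ℓ ^ (2 * (i : ℤ) - n)) / (1 - ℓ ^ ((i : ℤ) - n))) - 1|
      ≤ 2 * ℓ ^ (2 * (r : ℤ) - 1 - n) := by
  obtain ⟨-, h1, h2⟩ := product_bounds hℓ h
  rw [abs_of_nonpos (by linarith)]
  linarith
end
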